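/- arXiv:0812.2793 — 3 statements merged into one kernel-verified Lean document; each statement's English description precedes it below -/
import Mathlib

section
/- Let a be a boundary point of a ℂ-convex domain D ⊆ ℂ^n. Then γ_D(z;X) → ∞ as z → a, locally uniformly in X ∉ L_a; that is, for every M > 0 and every X ∉ L_a there exist neighborhoods U of a and V of X such that γ_D(z;Y) > M for every z ∈ D ∩ U and every Y ∈ V \ L_a. -/
open Complex Metric Set MeasureTheory

noncomputable section

/-- `ℂ^n` with the Euclidean (Hermitian) structure. -/
abbrev Cn (n : ℕ) := EuclideanSpace ℂ (Fin n)

instance (n : ℕ) : MeasurableSpace (Cn n) := borel _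
instance (n : ℕ) : BorelSpace (Cn n) := ⟨rfl⟩

/-- The complex affine line through `z` in direction `X`. -/
def cline {n : ℕ} (z X : Cn n) : Set (Cn n) := {w | ∃ l : ℂ, w = z + l • X}

/-- A domain: a nonempty connected open set. -/
def IsDomain' {n : ℕ} (D : Set (Cn n)) : Prop := IsOpen D ∧ IsConnected D

/-- `D` is ℂ-convex: its intersection with every complex affine line is, when
nonempty, connected and simply connected. -/
def IsCConvex {n : ℕ} (D : Set (Cn n)) : Prop :=
  ∀ z X : Cn n, X ≠ 0 → (D ∩ cline z X).Nonempty →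
    IsConnected (D ∩ cline z X) ∧ SimplyConnectedSpace ↥(D ∩ cline z X)

/-- The Carathéodory metric `γ_D(z;X)`. -/
def caraMetric {n : ℕ} (D : Set (Cn n)) (z X : Cn n) : ℝ :=
  sSup {r : ℝ | ∃ f : Cn n → ℂ, DifferentiableOn ℂ f D ∧ MapsTo f D (ball (0:ℂ) 1) ∧
    f z = 0 ∧ r = ‖fderiv ℂ f z X‖}

/-- The Kobayashi metric `κ_D(z;X)`. -/
def kobMetric {n : ℕ} (D : Set (Cn n)) (z X : Cn n) : ℝ :=
  sInf {a : ℝ | 0 ≤ a ∧ ∃ φ : ℂ → Cn n, DifferentiableOn ℂ φ (ball (0:ℂ) 1) ∧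
    MapsTo φ (ball (0:ℂ) 1) D ∧ φ 0 = z ∧ a • (fderiv ℂ φ 0 1) = X}

/-- The distance `d_D(z,X)` from `z` to `∂D` in direction `X`. -/
def dirDist {n : ℕ} (D : Set (Cn n)) (z X : Cn n) : ℝ :=
  sSup {r : ℝ | 0 < r ∧ ∀ l : ℂ, ‖l‖ < r → z + l • X ∈ D}

/-- The Euclidean distance `d_D(z)` from `z` to `∂D`. -/
def bdist {n : ℕ} (D : Set (Cn n)) (z : Cn n) : ℝ := Metric.infDist z (frontier D)

/-- `L_a`: the set of vectors `X` such that a disc `{a + λX : |λ| < ε}` lies in `∂D`. -/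
def La {n : ℕ} (D : Set (Cn n)) (a : Cn n) : Set (Cn n) :=
  {X | ∃ ε > (0:ℝ), ∀ l : ℂ, ‖l‖ < ε → a + l • X ∈ frontier D}

/-- `D` contains no complex affine line. -/
def NoComplexLine {n : ℕ} (D : Set (Cn n)) : Prop :=
  ¬ ∃ z X : Cn n, X ≠ 0 ∧ cline z X ⊆ D

/-- The Bergman kernel `K_D(z)` (restricted to the diagonal). -/
def bergmanKernel {n : ℕ} (D : Set (Cn n)) (z : Cn n) : ℝ :=
  sSup {r : ℝ | ∃ f : Cn n → ℂ, DifferentiableOn ℂ f D ∧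
    IntegrableOn (fun w => ‖f w‖ ^ 2) D ∧ (∫ w in D, ‖f w‖ ^ 2) ≤ 1 ∧ r = ‖f z‖ ^ 2}

/-- `M_D(z;X)`. -/
def bergmanM {n : ℕ} (D : Set (Cn n)) (z X : Cn n) : ℝ :=
  sSup {r : ℝ | ∃ f : Cn n → ℂ, DifferentiableOn ℂ f D ∧
    IntegrableOn (fun w => ‖f w‖ ^ 2) D ∧ (∫ w in D, ‖f w‖ ^ 2) = 1 ∧
    f z = 0 ∧ r = ‖fderiv ℂ f z X‖}

/-- The Bergman metric `B_D(z;X) = M_D(z;X)/√K_D(z)`. -/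
def bergmanMetric {n : ℕ} (D : Set (Cn n)) (z X : Cn n) : ℝ :=
  bergmanM D z X / Real.sqrt (bergmanKernel D z)

/-- `G` is weakly linearly convex: through every boundary point there is a complex
affine hyperplane missing `G`. -/
def WeaklyLinConvex {n : ℕ} (G : Set (Cn n)) : Prop :=
  ∀ a ∈ frontier G, ∃ ℓ : Cn n →L[ℂ] ℂ, ℓ ≠ 0 ∧ ∀ z ∈ G, ℓ z ≠ ℓ a

/-- `d_{j,D}(z)` from the minimal-distance construction: the distance from `z` to the
boundary of the slice of `D` by the affine subspace `z + span{v_i : i ≥ j}`. -/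
def sliceDist {n : ℕ} (D : Set (Cn n)) (z : Cn n) (v : Fin n → Cn n) (j : Fin n) : ℝ :=
  sSup {r : ℝ | 0 < r ∧
    ∀ w ∈ Submodule.span ℂ (v '' {i | j ≤ i}), ‖w‖ < r → z + w ∈ D}

/-- The data `(v j)` is an admissible output of the minimal-distance construction at `z`:
the directions are orthonormal and each `v j` realizes the distance `d_{j,D}(z)` to the
boundary of the corresponding slice. -/
def MinimalBasis {n : ℕ} (D : Set (Cn n)) (z : Cn n) (v : Fin n → Cn n) : Prop :=
  Orthonormal ℂ v ∧ ∀ j : Fin n, z + (sliceDist D z v j) • v j ∉ D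


theorem isLocalHomeomorph_cexp : IsLocalHomeomorph Complex.exp :=
  (isClosed_singleton.isOpen_compl.isOpenEmbedding_subtypeVal.isLocalHomeomorph).comp
    Complex.isCoveringMap_exp.isLocalHomeomorph

theorem eqOn_of_exp_eq {A : Type*} [TopologicalSpace A] {s : Set A} (hs : IsPreconnected s)
    {g₁ g₂ : A → ℂ} (h₁ : ContinuousOn g₁ s) (h₂ : ContinuousOn g₂ s)
    (he : ∀ x ∈ s, Complex.exp (g₁ x) = Complex.exp (g₂ x)) {a : A} (ha : a ∈ s)
    (hga : g₁ a = g₂ a) : EqOn g₁ g₂ s :=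
  (T2Space.isSeparatedMap Complex.exp).eqOn_of_comp_eqOn
    isLocalHomeomorph_cexp.isLocallyInjective hs h₁ h₂ he ha hga

/-- The parameters of those points of the complex line through `q` and `p` that lie in `S`. -/
def lineSlice {E : Type*} [AddCommGroup E] [Module ℂ E] (S : Set E) (p q : E) : Set ℂ :=
  {c | q + c • (p - q) ∈ S}

/-- The nonempty intersections of `S` with complex lines are simply connected. -/
def LineSimplyConnected {E : Type*} [AddCommGroup E] [Module ℂ E] (S : Set E) : Prop :=
  ∀ p ∈ S, ∀ q ∈ S, IsSimplyConnected (lineSlice S p q)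

section LogBranch

variable {E : Type*} [NormedAddCommGroup E] [NormedSpace ℂ E]

theorem zero_mem_lineSlice {S : Set E} {p q : E} (hq : q ∈ S) : (0 : ℂ) ∈ lineSlice S p q := by
  simpa [lineSlice] using hq

theorem one_mem_lineSlice {S : Set E} {p q : E} (hp : p ∈ S) : (1 : ℂ) ∈ lineSlice S p q := by
  simpa [lineSlice] using hp

theorem exists_log_on_lineSlice {S : Set E} (hS : IsOpen S) (hSC : LineSimplyConnected S)
    {h : E → ℂ} (hh : Continuous h) (h0 : ∀ x ∈ S, h x ≠ 0) {p q : E} (hp : p ∈ S) (hq : q ∈ S) :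
    ∃ G : ℂ → ℂ, ContinuousOn G (lineSlice S p q) ∧ G 0 = 0 ∧
      ∀ c ∈ lineSlice S p q, Complex.exp (G c) = h (q + c • (p - q)) / h q := by
  have hopen : IsOpen (lineSlice S p q) := hS.preimage (by fun_prop)
  obtain ⟨f, hf, hfe⟩ := Complex.exists_continuousOn_eqOn_exp_comp (hSC p hp q hq) hopen
    (g := fun c => h (q + c • (p - q)) / h q) (by fun_prop)
    (by
      rintro ⟨c, hc, hc0⟩
      exact div_ne_zero (h0 _ hc) (h0 q hq) hc0)
  refine ⟨fun c => f c - f 0, by fun_prop, by simp, fun c hc => ?_⟩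
  have e0 := hfe (zero_mem_lineSlice (p := p) hq)
  have ec := hfe hc
  simp only [Function.comp_apply, zero_smul, add_zero, div_self (h0 q hq)] at e0 ec
  rw [Complex.exp_sub, e0, ec, div_one]

/-- In a family of open sets with simply connected complex line slices, the logarithm of the
quotient of two values of a nonvanishing function has a continuous branch. -/
theorem exists_log_div {B : Type*} [TopologicalSpace B] {F : B → Set E}
    (hF : IsOpen {x : B × E | x.2 ∈ F x.1}) (hSC : ∀ w, LineSimplyConnected (F w))
    {h : E → ℂ} (hh : Continuous h) (h0 : ∀ w, ∀ x ∈ F w, h x ≠ 0) :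
    ∃ Λ : B → E → E → ℂ,
      (∀ w, ∀ p ∈ F w, ∀ q ∈ F w, Complex.exp (Λ w p q) = h p / h q) ∧
      (∀ w, ∀ p ∈ F w, Λ w p p = 0) ∧
      ContinuousOn (fun x : B × E × E => Λ x.1 x.2.1 x.2.2)
        {x | x.2.1 ∈ F x.1 ∧ x.2.2 ∈ F x.1} := by
  classical
  have hFo : ∀ w, IsOpen (F w) := fun w => hF.preimage (Continuous.prodMk_right w)
  have key : ∀ w p q, ∃ G : ℂ → ℂ, p ∈ F w → q ∈ F w →
      ContinuousOn G (lineSlice (F w) p q) ∧ G 0 = 0 ∧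
      ∀ c ∈ lineSlice (F w) p q, Complex.exp (G c) = h (q + c • (p - q)) / h q := by
    intro w p q
    by_cases hpq : p ∈ F w ∧ q ∈ F w
    · obtain ⟨G, hG⟩ := exists_log_on_lineSlice (hFo w) (hSC w) hh (h0 w) hpq.1 hpq.2
      exact ⟨G, fun _ _ => hG⟩
    · exact ⟨0, fun a b => absurd ⟨a, b⟩ hpq⟩
  choose G hG using key
  refine ⟨fun w p q => G w p q 1, ?_, ?_, ?_⟩
  · intro w p hp q hq
    simpa using (hG w p q hp hq).2.2 1 (one_mem_lineSlice hp)
  · intro w p hp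
    obtain ⟨hc, hz, he⟩ := hG w p p hp hp
    have hu : lineSlice (F w) p p = univ := by ext c; simp [lineSlice, hp]
    rw [hu] at hc he
    refine eqOn_of_exp_eq isPreconnected_univ hc (continuousOn_const (c := (0 : ℂ))) ?_
      (mem_univ 0) hz (mem_univ 1)
    intro c hcu
    simp [he c hcu, h0 w p hp]
  · rintro ⟨w₀, p₀, q₀⟩ ⟨hp₀, hq₀⟩
    simp only at hp₀ hq₀
    obtain ⟨γ, hγ⟩ := (hSC w₀ p₀ hp₀ q₀ hq₀).isPathConnected.joinedIn 0
      (zero_mem_lineSlice hq₀) 1 (one_mem_lineSlice hp₀)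
    let W : Set (B × E × E) := {x | ∀ s : unitInterval, x.2.2 + γ s • (x.2.1 - x.2.2) ∈ F x.1}
    have hWn : W ∈ nhds (w₀, p₀, q₀) := by
      have := isCompact_univ.eventually_forall_of_forall_eventually (x₀ := (w₀, p₀, q₀))
        (K := (univ : Set unitInterval))
        (P := fun x s => x.2.2 + γ s • (x.2.1 - x.2.2) ∈ F x.1) (fun s _ => by
          have hc : Continuous fun y : (B × E × E) × unitInterval =>
              (y.1.1, y.1.2.2 + γ y.2 • (y.1.2.1 - y.1.2.2)) := by fun_prop
          exact (hF.preimage hc).mem_nhds (hγ s))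
      filter_upwards [this] with x hx s using hx s (mem_univ s)
    have hWp : ∀ x ∈ W, x.2.1 ∈ F x.1 := fun x hx => by simpa using hx 1
    have hWq : ∀ x ∈ W, x.2.2 ∈ F x.1 := fun x hx => by simpa using hx 0
    let f : C(unitInterval × W, ℂ) :=
      ⟨fun y => h (y.2.1.2.2 + γ y.1 • (y.2.1.2.1 - y.2.1.2.2)) / h y.2.1.2.2, by
        refine Continuous.div (by fun_prop) (by fun_prop) fun y => ?_
        exact h0 y.2.1.1 _ (hWq _ y.2.2)⟩
    have hcont := isLocalHomeomorph_cexp.continuous_lift (T2Space.isSeparatedMap Complex.exp) f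
      (g := fun y => G y.2.1.1 y.2.1.2.1 y.2.1.2.2 (γ y.1))
      (by
        ext y
        exact (hG _ _ _ (hWp _ y.2.2) (hWq _ y.2.2)).2.2 _ (y.2.2 y.1))
      (by
        have : ∀ y : W, G y.1.1 y.1.2.1 y.1.2.2 (γ 0) = 0 := fun y => by
          rw [γ.source]; exact (hG _ _ _ (hWp _ y.2) (hWq _ y.2)).2.1
        simpa only [this] using continuous_const)
      (fun y => (hG _ _ _ (hWp _ y.2) (hWq _ y.2)).1.comp_continuous γ.continuous
        fun s => y.2 s)
    have hcW : ContinuousOn (fun x : B × E × E => G x.1 x.2.1 x.2.2 1) W := by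
      rw [continuousOn_iff_continuous_domRestrict]
      have := hcont.comp (Continuous.prodMk_right (1 : unitInterval))
      simpa [Function.comp_def, Set.domRestrict_def] using! this
    exact (hcW.continuousAt hWn).continuousWithinAt

end LogBranch
section LogFamily

variable {E : Type*} [NormedAddCommGroup E] [NormedSpace ℂ E]
variable {B : Type*} [TopologicalSpace B]

theorem add_eq_of_log_div {S : Set E} (hSC : LineSimplyConnected S) {h : E → ℂ}
    (h0 : ∀ x ∈ S, h x ≠ 0) {Λ : E → E → ℂ}
    (he : ∀ p ∈ S, ∀ q ∈ S, Complex.exp (Λ p q) = h p / h q) (hd : ∀ p ∈ S, Λ p p = 0)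
    (hc : ∀ q ∈ S, ContinuousOn (fun p => Λ p q) S) {p p' r : E} (hp : p ∈ S) (hp' : p' ∈ S)
    (hr : r ∈ S) : Λ p p' + Λ p' r = Λ p r := by
  have hl : Continuous fun c : ℂ => p' + c • (p - p') := by fun_prop
  have := eqOn_of_exp_eq (hSC p hp p' hp').isPathConnected.isConnected.isPreconnected
    (g₁ := fun c => Λ (p' + c • (p - p')) p' + Λ p' r) (g₂ := fun c => Λ (p' + c • (p - p')) r)
    (((hc p' hp').comp hl.continuousOn fun c hc => hc).add continuousOn_const)
    ((hc r hr).comp hl.continuousOn fun c hc => hc)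
    (fun c hc => by
      rw [Complex.exp_add, he _ hc _ hp', he _ hp' _ hr, he _ hc _ hr]
      have := h0 _ hp'
      have := h0 _ hr
      field_simp)
    (zero_mem_lineSlice hp') (by simp [hd p' hp'])
  simpa using this (one_mem_lineSlice hp)

/-- A nonvanishing function has a continuous logarithm on a family, over a simply connected base,
of open sets with simply connected complex line slices. -/
theorem exists_log_of_family [NormalSpace B] [ParacompactSpace B] [SimplyConnectedSpace B]
    [LocallyPathConnectedSpace B] {F : B → Set E}
    (hF : IsOpen {x : B × E | x.2 ∈ F x.1}) (hSC : ∀ w, LineSimplyConnected (F w))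
    (hne : ∀ w, (F w).Nonempty) {h : E → ℂ} (hh : Continuous h)
    (h0 : ∀ w, ∀ x ∈ F w, h x ≠ 0) :
    ∃ T : B → E → ℂ, (∀ w, ∀ p ∈ F w, Complex.exp (T w p) = h p) ∧
      ContinuousOn (fun x : B × E => T x.1 x.2) {x | x.2 ∈ F x.1} := by
  obtain ⟨Λ, hΛe, hΛd, hΛc⟩ := exists_log_div hF hSC hh h0
  have hcoc : ∀ w, ∀ p ∈ F w, ∀ p' ∈ F w, ∀ r ∈ F w, Λ w p p' + Λ w p' r = Λ w p r := by
    intro w p hp p' hp' r hr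
    refine add_eq_of_log_div (hSC w) (h0 w) (hΛe w) (hΛd w) (fun q hq => ?_) hp hp' hr
    exact hΛc.comp (f := fun p : E => (w, p, q)) (by fun_prop) fun p hp => ⟨hp, hq⟩
  obtain ⟨ρ, hρ⟩ := PartitionOfUnity.exists_isSubordinate (isClosed_univ (X := B))
    (fun P : E => {w | P ∈ F w}) (fun P => hF.preimage (Continuous.prodMk_left P))
    (fun w _ => by
      obtain ⟨P, hP⟩ := hne w
      exact mem_iUnion.2 ⟨P, hP⟩)
  have hρF : ∀ w P, ρ P w ≠ 0 → P ∈ F w := fun w P hP => hρ P (subset_closure hP)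
  let A : B → E → ℂ := fun w p => ∑ᶠ P, ρ P w • Λ w p P
  have hfin : ∀ w p, (Function.support fun P => ρ P w • Λ w p P).Finite := fun w p =>
    (ρ.locallyFinite.point_finite w).subset fun _ hP => left_ne_zero_of_smul hP
  have hAsub : ∀ w, ∀ p ∈ F w, ∀ p' ∈ F w, A w p = Λ w p p' + A w p' := by
    intro w p hp p' hp'
    have h1 : Λ w p p' = ∑ᶠ P, ρ P w • Λ w p p' := by
      rw [← finsum_smul' (ρ.locallyFinite.point_finite w), ρ.sum_eq_one (mem_univ w), one_smul]
    rw [h1, ← finsum_add_distrib ((ρ.locallyFinite.point_finite w).subset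
      fun _ hP => left_ne_zero_of_smul hP) (hfin w p')]
    refine finsum_congr fun P => ?_
    by_cases hP : ρ P w = 0
    · simp [hP]
    · rw [← smul_add, hcoc w p hp p' hp' P (hρF w P hP)]
  have hAc : ContinuousOn (fun x : B × E => A x.1 x.2) {x | x.2 ∈ F x.1} := by
    rw [continuousOn_iff_continuous_domRestrict]
    refine continuous_finsum (fun P => ?_) ?_
    · refine (continuousOn_iff_continuous_domRestrict
        (f := fun x : B × E => ρ P x.1 • Λ x.1 x.2 P)).1 fun x hx => ?_
      by_cases hP : x.1 ∈ tsupport (ρ P)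
      · have hP' : P ∈ F x.1 := hρ P hP
        have hopen : IsOpen {x : B × E × E | x.2.1 ∈ F x.1 ∧ x.2.2 ∈ F x.1} := by
          refine IsOpen.inter ?_ ?_
          · exact hF.preimage (f := fun x : B × E × E => (x.1, x.2.1)) (by fun_prop)
          · exact hF.preimage (f := fun x : B × E × E => (x.1, x.2.2)) (by fun_prop)
        have h1 : ContinuousAt (fun x : B × E => Λ x.1 x.2 P) x :=
          ContinuousAt.comp (f := fun x : B × E => (x.1, x.2, P))
            (g := fun x : B × E × E => Λ x.1 x.2.1 x.2.2)
            (hΛc.continuousAt (hopen.mem_nhds ⟨hx, hP'⟩)) (by fun_prop)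
        have h2 : ContinuousAt (fun x : B × E => ρ P x.1) x := by fun_prop
        exact (h2.smul h1).continuousWithinAt
      · have hev : ∀ᶠ y : B × E in nhds x, ρ P y.1 • Λ y.1 y.2 P = 0 := by
          have : ∀ᶠ w in nhds x.1, ρ P w = 0 := notMem_tsupport_iff_eventuallyEq.1 hP
          filter_upwards [continuousAt_fst.eventually this] with y hy
          simp [hy]
        exact (ContinuousAt.congr (continuousAt_const (y := (0 : ℂ)))
          (hev.mono fun y hy => hy.symm)).continuousWithinAt
    · have h1 := ρ.locallyFinite.preimage_continuous
        (g := fun x : {x : B × E | x.2 ∈ F x.1} => x.1.1) (by fun_prop)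
      refine h1.subset fun P x hx => ?_
      exact left_ne_zero_of_smul hx
  choose s hs using hne
  let N : B → ℂ := fun w => h (s w) * Complex.exp (-A w (s w))
  have hN : ∀ w, ∀ p ∈ F w, N w = h p * Complex.exp (-A w p) := by
    intro w p hp
    have := h0 w p hp
    simp only [N]
    rw [hAsub w (s w) (hs w) p hp, neg_add, Complex.exp_add, Complex.exp_neg (Λ w (s w) p),
      hΛe w _ (hs w) p hp]
    have := h0 w _ (hs w)
    field_simp
  have hNc : Continuous N := by
    rw [continuous_iff_continuousAt]
    intro w
    have hev : ∀ᶠ w' in nhds w, s w ∈ F w' :=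
      (hF.preimage (Continuous.prodMk_left (s w))).mem_nhds (hs w)
    refine ContinuousAt.congr (f := fun w' => h (s w) * Complex.exp (-A w' (s w))) ?_
      (hev.mono fun w' hw' => (hN w' _ hw').symm)
    have : ContinuousAt (fun w' => A w' (s w)) w :=
      ContinuousAt.comp (f := fun w' : B => (w', s w)) (g := fun x : B × E => A x.1 x.2)
        (hAc.continuousAt (hF.mem_nhds (hs w))) (by fun_prop)
    fun_prop
  have hu : IsSimplyConnected (univ : Set B) :=
    (Homeomorph.Set.univ B).toHomotopyEquiv.simplyConnectedSpace
  obtain ⟨K, hKc, hKe⟩ := Complex.exists_continuousOn_eqOn_exp_comp hu isOpen_univ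
    hNc.continuousOn (by
      rintro ⟨w, -, hw⟩
      exact mul_ne_zero (h0 w _ (hs w)) (Complex.exp_ne_zero _) hw)
  rw [continuousOn_univ] at hKc
  refine ⟨fun w p => K w + A w p, fun w p hp => ?_, ?_⟩
  · have : Complex.exp (K w) = N w := hKe (mem_univ w)
    rw [Complex.exp_add, this, hN w p hp, mul_assoc, ← Complex.exp_add]
    simp
  · exact (hKc.comp continuous_fst).continuousOn.add hAc

end LogFamily
section Hyperplane

variable {E : Type*} [NormedAddCommGroup E] [NormedSpace ℂ E]

theorem LineSimplyConnected.preimage {E' : Type*} [AddCommGroup E'] [Module ℂ E'] {S : Set E}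
    (hS : LineSimplyConnected S) (b : E) (Φ : E' →ₗ[ℂ] E) :
    LineSimplyConnected {x | b + Φ x ∈ S} := by
  intro p hp q hq
  have : lineSlice {x | b + Φ x ∈ S} p q = lineSlice S (b + Φ p) (b + Φ q) := by
    ext c
    simp only [lineSlice, mem_ofPred_eq, map_add, map_smul, map_sub, add_sub_add_left_eq_sub,
      add_assoc]
  rw [this]
  exact hS _ hp _ hq

/-- A subspace missing an open set with simply connected complex line slices cannot have the
property that every one-dimensional extension inside a two-dimensional one meets the set. -/
theorem not_forall_exists_mem_of_lineSimplyConnected {D : Set E} (hD : IsOpen D)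
    (hSC : LineSimplyConnected D) {b : E} {A : Submodule ℂ E} (hA : ∀ x ∈ A, b + x ∉ D)
    {v₁ v₂ : E} (hv : ∀ α β : ℂ, (α ≠ 0 ∨ β ≠ 0) →
      ∃ x ∈ A, ∃ τ : ℂ, b + (x + τ • (α • v₁ + β • v₂)) ∈ D) : False := by
  let κ : ℂ → ℂ := fun w => ((max (1 - ‖w‖) 0 : ℝ) : ℂ)
  have hκ : Continuous κ := by fun_prop
  let Φ : ℂ → (A × ℂ) →ₗ[ℂ] E := fun w =>
    A.subtype.coprod (LinearMap.toSpanSingleton ℂ E (w • v₁ + κ w • v₂))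
  have hΦ : ∀ w x, Φ w x = x.1 + x.2 • (w • v₁ + κ w • v₂) := fun w x => by simp [Φ]
  let F : ℂ → Set (A × ℂ) := fun w => {x | b + Φ w x ∈ D}
  have hF : IsOpen {x : ℂ × (A × ℂ) | x.2 ∈ F x.1} := by
    refine hD.preimage (f := fun x : ℂ × (A × ℂ) => b + Φ x.1 x.2) ?_
    simp only [hΦ]
    fun_prop
  have hne : ∀ w, (F w).Nonempty := by
    intro w
    obtain ⟨x, hx, τ, h⟩ := hv w (κ w) (by
      by_cases hw : w = 0
      · right; simp [κ, hw]
      · exact Or.inl hw)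
    exact ⟨(⟨x, hx⟩, τ), by simpa [F, hΦ] using h⟩
  have h0 : ∀ w, ∀ x ∈ F w, x.2 ≠ 0 := by
    intro w x hx h
    refine hA x.1 x.1.2 ?_
    simpa [F, hΦ, h] using hx
  obtain ⟨T, hTe, hTc⟩ := exists_log_of_family hF (fun w => hSC.preimage b (Φ w)) hne
    continuous_snd h0
  obtain ⟨⟨x, τ⟩, hx⟩ := hne 1
  have hmem : ∀ θ : ℝ, (x, τ * Complex.exp (-(θ * Complex.I))) ∈
      F (Complex.exp (θ * Complex.I)) := by
    intro θ
    have h1 : κ 1 = 0 := by simp [κ]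
    have h2 : κ (Complex.exp (θ * Complex.I)) = 0 := by
      simp [κ, Complex.norm_exp_ofReal_mul_I]
    have h3 : Complex.exp (-(θ * Complex.I)) * Complex.exp (θ * Complex.I) = 1 := by
      rw [← Complex.exp_add]; simp
    simp only [F, mem_ofPred_eq, hΦ, h1, h2] at hx ⊢
    simpa [smul_smul, mul_assoc, h3] using hx
  have hc : Continuous fun θ : ℝ => T (Complex.exp (θ * Complex.I))
      (x, τ * Complex.exp (-(θ * Complex.I))) + θ * Complex.I := by
    refine Continuous.add ?_ (by fun_prop)
    exact hTc.comp_continuous (f := fun θ : ℝ => (Complex.exp (θ * Complex.I),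
      (x, τ * Complex.exp (-(θ * Complex.I))))) (by fun_prop) hmem
  have := eqOn_of_exp_eq isPreconnected_univ hc.continuousOn
    (continuousOn_const (c := T 1 (x, τ))) (fun θ _ => by
      rw [Complex.exp_add, hTe _ _ (hmem θ), hTe _ _ hx, mul_assoc, ← Complex.exp_add]
      simp) (mem_univ 0) (by simp) (mem_univ (2 * Real.pi))
  simp [Complex.exp_neg, Complex.exp_two_pi_mul_I, Real.pi_ne_zero] at this

/-- Through every point outside an open set with simply connected complex line slices there is a
complex hyperplane missing the set. -/
theorem exists_linearMap_ne_zero_of_notMem [FiniteDimensional ℂ E] {D : Set E} (hD : IsOpen D)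
    (hne : D.Nonempty) (hSC : LineSimplyConnected D) {b : E} (hb : b ∉ D) :
    ∃ ℓ : E →L[ℂ] ℂ, ∀ x ∈ D, ℓ (x - b) ≠ 0 := by
  obtain ⟨A, hA, hmax⟩ := (wellFounded_gt (α := Submodule ℂ E)).has_min
    {A | ∀ x ∈ A, b + x ∉ D} ⟨⊥, by simpa using hb⟩
  have hext : ∀ v, v ∉ A → ∃ x ∈ A, ∃ τ : ℂ, b + (x + τ • v) ∈ D := by
    intro v hv
    by_contra! hcon
    refine hmax (A ⊔ Submodule.span ℂ {v}) (fun y hy => ?_) ?_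
    · obtain ⟨x, hx, z, hz, rfl⟩ := Submodule.mem_sup.1 hy
      obtain ⟨τ, rfl⟩ := Submodule.mem_span_singleton.1 hz
      exact hcon x hx τ
    · refine lt_of_le_of_ne le_sup_left fun h => hv ?_
      rw [h]
      exact Submodule.mem_sup_right (Submodule.mem_span_singleton_self v)
  obtain ⟨x₀, hx₀⟩ := hne
  have hv₁ : x₀ - b ∉ A := fun h => hA _ h (by simpa using hx₀)
  set v₁ := x₀ - b
  have htop : ∀ v, v ∈ A ⊔ Submodule.span ℂ {v₁} := by
    by_contra! hcon
    obtain ⟨v₂, hv₂⟩ := hcon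
    refine not_forall_exists_mem_of_lineSimplyConnected hD hSC hA (v₁ := v₁) (v₂ := v₂)
      fun α β hαβ => hext _ fun hmem => ?_
    by_cases hβ : β = 0
    · have hα : α ≠ 0 := by simpa [hβ] using hαβ
      exact hv₁ ((A.smul_mem_iff hα).1 (by simpa [hβ] using hmem))
    · refine hv₂ (((A ⊔ Submodule.span ℂ {v₁}).smul_mem_iff hβ).1 ?_)
      have h1 := (A ⊔ Submodule.span ℂ {v₁}).sub_mem (Submodule.mem_sup_left hmem)
        (Submodule.mem_sup_right ((Submodule.span ℂ {v₁}).smul_mem α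
          (Submodule.mem_span_singleton_self v₁)))
      simpa using h1
  obtain ⟨f, hf, hfA⟩ := Submodule.exists_le_ker_of_notMem hv₁
  refine ⟨LinearMap.toContinuousLinearMap f, fun x hx h => ?_⟩
  obtain ⟨y, hy, z, hz, hyz⟩ := Submodule.mem_sup.1 (htop (x - b))
  obtain ⟨τ, rfl⟩ := Submodule.mem_span_singleton.1 hz
  have hfy : f y = 0 := hfA hy
  rw [← hyz] at h
  have hτ : τ = 0 := by simpa [hfy, hf] using h
  refine hA y hy ?_
  have : y = x - b := by simpa [hτ] using hyz
  rw [this]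
  simpa using hx

end Hyperplane
section Logarithm

variable {E : Type*} [NormedAddCommGroup E] [NormedSpace ℂ E]

theorem exists_log_of_lineSimplyConnected {D : Set E} (hD : IsOpen D) (hne : D.Nonempty)
    (hSC : LineSimplyConnected D) {h : E → ℂ} (hh : Continuous h) (h0 : ∀ x ∈ D, h x ≠ 0) :
    ∃ G : E → ℂ, ContinuousOn G D ∧ ∀ x ∈ D, Complex.exp (G x) = h x := by
  obtain ⟨T, hTe, hTc⟩ := exists_log_of_family (B := ℂ) (F := fun _ => D)
    (hD.preimage continuous_snd) (fun _ => hSC) (fun _ => hne) hh fun _ => h0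
  exact ⟨T 0, hTc.comp (Continuous.prodMk_right (0 : ℂ)).continuousOn fun x hx => hx, hTe 0⟩

theorem hasFDerivAt_of_exp_eq {G h : E → ℂ} {h' : E →L[ℂ] ℂ} {x : E} (hG : ContinuousAt G x)
    (he : ∀ᶠ y in nhds x, Complex.exp (G y) = h y) (hh : HasFDerivAt h h' x) :
    HasFDerivAt G ((h x)⁻¹ • h') x := by
  have hx : Complex.exp (G x) = h x := he.self_of_nhds
  have hx0 : h x ≠ 0 := hx ▸ Complex.exp_ne_zero _
  have h1 : HasFDerivAt (fun y => (h x)⁻¹ * h y) ((h x)⁻¹ • h') x := hh.const_mul _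
  have h2 := (h1.clog (by simp [hx0])).const_add (G x)
  simp only [inv_mul_cancel₀ hx0, inv_one, one_smul] at h2
  refine h2.congr_of_eventuallyEq ?_
  have him : ContinuousAt (fun y => (G y - G x).im) x := by fun_prop
  have hs : Ioo (-Real.pi) Real.pi ∈ nhds ((G x - G x).im) := by
    simpa using Ioo_mem_nhds (neg_lt_zero.2 Real.pi_pos) Real.pi_pos
  filter_upwards [he, him hs] with y hy hy'
  rw [← hx, ← hy, ← Complex.exp_neg, ← Complex.exp_add, neg_add_eq_sub,
    Complex.log_exp hy'.1 hy'.2.le]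
  ring

/-- If the affine line `z + ℂ Y` leaves `D` at parameter `l`, some holomorphic map from `D` to the
unit disc vanishing at `z` has derivative at least `1 / (32 |l|)` in the direction `Y`. -/
theorem exists_mapsTo_ball_of_notMem [FiniteDimensional ℂ E] {D : Set E} (hD : IsOpen D)
    (hSC : LineSimplyConnected D) {z Y : E} (hz : z ∈ D) {l₀ : ℂ} (hl₀ : z + l₀ • Y ∉ D) :
    ∃ f : E → ℂ, DifferentiableOn ℂ f D ∧ MapsTo f D (ball (0 : ℂ) 1) ∧ f z = 0 ∧
      1 / (32 * ‖l₀‖) ≤ ‖fderiv ℂ f z Y‖ := by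
  have hclosed : IsClosed {l : ℂ | z + l • Y ∉ D} :=
    (hD.preimage (f := fun l : ℂ => z + l • Y) (by fun_prop)).isClosed_compl
  obtain ⟨l, hl, hdist⟩ := hclosed.exists_infDist_eq_dist ⟨l₀, hl₀⟩ 0
  rw [dist_zero_left] at hdist
  have hl_le : ‖l‖ ≤ ‖l₀‖ := by
    simpa [hdist] using infDist_le_dist_of_mem (x := (0 : ℂ)) (s := {l : ℂ | z + l • Y ∉ D}) hl₀
  have hball : ∀ t ∈ ball (0 : ℂ) ‖l‖, z + t • Y ∈ D := by
    intro t ht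
    by_contra hcon
    have := infDist_le_dist_of_mem (x := (0 : ℂ)) (s := {l : ℂ | z + l • Y ∉ D}) hcon
    rw [hdist, dist_comm] at this
    exact not_le.2 (mem_ball.1 ht) this
  have hl0 : l ≠ 0 := by
    rintro rfl
    exact hl (by simpa using hz)
  have hlpos : 0 < ‖l‖ := norm_pos_iff.2 hl0
  obtain ⟨ℓ, hℓ⟩ := exists_linearMap_ne_zero_of_notMem hD ⟨z, hz⟩ hSC hl
  have hℓz : ℓ (z - (z + l • Y)) = -(l * ℓ Y) := by simp
  have hℓY : ℓ Y ≠ 0 := fun h => hℓ z hz (by rw [hℓz, h]; simp)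
  let h : E → ℂ := fun x => (-(l * ℓ Y))⁻¹ * ℓ (x - (z + l • Y))
  have hh : Continuous h := by fun_prop
  have h0 : ∀ x ∈ D, h x ≠ 0 := fun x hx =>
    mul_ne_zero (inv_ne_zero (neg_ne_zero.2 (mul_ne_zero hl0 hℓY))) (hℓ x hx)
  have hline : ∀ t : ℂ, h (z + t • Y) = 1 - t / l := by
    intro t
    simp only [h, map_sub, map_add, map_smul, smul_eq_mul]
    field_simp
    ring
  have hfib : ∀ p q : E, h p = h q → ∀ c : ℂ, h (q + c • (p - q)) = h q := by
    intro p q hpq c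
    have hpq' : ℓ p = ℓ q := by
      have := mul_left_cancel₀ (inv_ne_zero (neg_ne_zero.2 (mul_ne_zero hl0 hℓY))) hpq
      simpa using this
    simp [h, hpq']
  have hh' : ∀ x, HasFDerivAt h ((-(l * ℓ Y))⁻¹ • ℓ) x := fun x =>
    (ℓ.hasFDerivAt.comp x ((hasFDerivAt_id x).sub_const _)).const_mul _
  obtain ⟨G, hGc, hGe⟩ := exists_log_of_lineSimplyConnected hD ⟨z, hz⟩ hSC hh h0
  have hGd : ∀ x ∈ D, HasFDerivAt G ((h x)⁻¹ • (-(l * ℓ Y))⁻¹ • ℓ) x := fun x hx =>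
    hasFDerivAt_of_exp_eq (hGc.continuousAt (hD.mem_nhds hx))
      (Filter.eventually_of_mem (hD.mem_nhds hx) hGe) (hh' x)
  have hhz : h z = 1 := by simpa using hline 0
  have hGfib : ∀ p ∈ D, ∀ q ∈ D, h p = h q → G p = G q := by
    intro p hp q hq hpq
    have := eqOn_of_exp_eq (hSC p hp q hq).isPathConnected.isConnected.isPreconnected
      (g₁ := fun c => G (q + c • (p - q))) (g₂ := fun _ => G q)
      (hGc.comp (by fun_prop) fun c hc => hc) continuousOn_const
      (fun c hc => by rw [hGe _ hc, hGe _ hq, hfib p q hpq c])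
      (zero_mem_lineSlice hq) (by simp)
    simpa using this (one_mem_lineSlice hp)
  have hGlog : ∀ t ∈ ball (0 : ℂ) ‖l‖, G (z + t • Y) - G z = Complex.log (1 - t / l) := by
    have hslit : ∀ t ∈ ball (0 : ℂ) ‖l‖, 1 - t / l ∈ Complex.slitPlane := by
      intro t ht
      rw [sub_eq_add_neg]
      refine Complex.mem_slitPlane_of_norm_lt_one ?_
      rw [norm_neg, norm_div, div_lt_one hlpos]
      simpa using ht
    refine eqOn_of_exp_eq (convex_ball (0 : ℂ) ‖l‖).isPreconnected
      (g₁ := fun t => G (z + t • Y) - G z) (g₂ := fun t => Complex.log (1 - t / l))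
      ((hGc.comp (by fun_prop) hball).sub continuousOn_const)
      (ContinuousOn.clog (by fun_prop) hslit) (fun t ht => ?_) (mem_ball_self hlpos) (by simp)
    rw [Complex.exp_sub, hGe _ (hball t ht), hGe z hz, hhz, hline, div_one,
      Complex.exp_log (Complex.slitPlane_ne_zero (hslit t ht))]
  let g : E → ℂ := fun x => Complex.exp ((G x - G z) / 2)
  have hg2 : ∀ x ∈ D, g x ^ 2 = h x := by
    intro x hx
    simp only [g]
    rw [← Complex.exp_nat_mul, Nat.cast_ofNat, mul_div_cancel₀ _ two_ne_zero, Complex.exp_sub,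
      hGe x hx, hGe z hz, hhz, div_one]
  have hg1 : ∀ x ∈ D, 1 / 3 ≤ ‖g x + 1‖ := by
    intro x hx
    by_contra! hlt
    have hlt2 : ‖1 - h x‖ < 1 := by
      have e : 1 - h x = (g x + 1) * (2 - (g x + 1)) := by rw [← hg2 x hx]; ring
      have h2 : ‖2 - (g x + 1)‖ ≤ 2 + ‖g x + 1‖ := (norm_sub_le _ _).trans (by simp)
      rw [e, norm_mul]
      nlinarith [norm_nonneg (g x + 1), norm_nonneg (2 - (g x + 1))]
    have ht : l * (1 - h x) ∈ ball (0 : ℂ) ‖l‖ := by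
      rw [mem_ball_zero_iff, norm_mul]
      exact mul_lt_of_lt_one_right hlpos hlt2
    have hq : h (z + (l * (1 - h x)) • Y) = h x := by
      rw [hline]
      field_simp
      ring
    have hGx := hGfib _ (hball _ ht) _ hx hq
    have hlog := hGlog _ ht
    rw [hGx, ← hline, hq] at hlog
    have hre : 0 ≤ (g x).re := by
      simp only [g]
      rw [hlog, Complex.exp_re]
      refine mul_nonneg (Real.exp_pos _).le (Real.cos_nonneg_of_mem_Icc ?_)
      have e : (Complex.log (h x) / 2).im = (h x).arg / 2 := by
        rw [show (2 : ℂ) = ((2 : ℝ) : ℂ) by simp, Complex.div_ofReal_im, Complex.log_im]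
      rw [e]
      constructor <;> linarith [Complex.neg_pi_lt_arg (h x), Complex.arg_le_pi (h x)]
    have := Complex.re_le_norm (g x + 1)
    simp only [Complex.add_re, Complex.one_re] at this
    linarith
  have hgne : ∀ x ∈ D, g x + 1 ≠ 0 := fun x hx h => by
    have := hg1 x hx
    rw [h, norm_zero] at this
    norm_num at this
  let φ : ℂ → ℂ := fun s => ((Complex.exp ((s - G z) / 2) + 1)⁻¹ - 1 / 2) / 4
  have hφ : ∀ s, Complex.exp ((s - G z) / 2) + 1 ≠ 0 → HasDerivAt φ
      (-(Complex.exp ((s - G z) / 2) * (1 / 2)) / (Complex.exp ((s - G z) / 2) + 1) ^ 2 / 4) s :=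
    fun s hs => ((((((hasDerivAt_id s).sub_const (G z)).div_const 2).cexp.add_const 1).inv
      hs).sub_const (1 / 2)).div_const 4
  have hf : ∀ x ∈ D, HasFDerivAt (φ ∘ G) _ x := fun x hx =>
    (hφ (G x) (hgne x hx)).comp_hasFDerivAt x (hGd x hx)
  refine ⟨φ ∘ G, fun x hx => (hf x hx).differentiableAt.differentiableWithinAt, fun x hx => ?_,
    ?_, ?_⟩
  · have h1 : ‖(g x + 1)⁻¹‖ ≤ 3 := by
      rw [norm_inv]
      exact inv_le_of_inv_le₀ (by norm_num) (by simpa using hg1 x hx)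
    have h2 : ‖(g x + 1)⁻¹ - 1 / 2‖ ≤ 3 + 1 / 2 :=
      (norm_sub_le _ _).trans (add_le_add h1 (by norm_num))
    rw [mem_ball_zero_iff]
    change ‖((g x + 1)⁻¹ - 1 / 2) / 4‖ < 1
    rw [norm_div, Complex.norm_ofNat]
    linarith
  · simp [φ]
    norm_num
  · rw [(hf z hz).fderiv]
    have e : ‖(-(Complex.exp ((G z - G z) / 2) * (1 / 2)) /
        (Complex.exp ((G z - G z) / 2) + 1) ^ 2 / 4) * ((h z)⁻¹ * ((-(l * ℓ Y))⁻¹ * ℓ Y))‖ =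
        1 / (32 * ‖l‖) := by
      have e' : (-(Complex.exp ((G z - G z) / 2) * (1 / 2)) /
        (Complex.exp ((G z - G z) / 2) + 1) ^ 2 / 4) * ((h z)⁻¹ * ((-(l * ℓ Y))⁻¹ * ℓ Y)) =
        1 / (32 * l) := by
        rw [sub_self, zero_div, Complex.exp_zero, hhz]
        field_simp
        norm_num
      rw [e', norm_div, norm_mul, norm_one, Complex.norm_ofNat]
    refine le_trans ?_ e.ge
    gcongr

end Logarithm
theorem IsCConvex.lineSimplyConnected {n : ℕ} {D : Set (Cn n)} (hcc : IsCConvex D) :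
    LineSimplyConnected D := by
  intro p hp q hq
  by_cases hpq : p = q
  · subst hpq
    have hu : lineSlice D p p = univ := by ext c; simp [lineSlice, hp]
    rw [hu]
    exact (Homeomorph.Set.univ ℂ).toHomotopyEquiv.simplyConnectedSpace
  · have hne : p - q ≠ 0 := sub_ne_zero.2 hpq
    have hemb : Topology.IsEmbedding fun c : ℂ => q + c • (p - q) :=
      (Homeomorph.addLeft q).isEmbedding.comp (isClosedEmbedding_smul_left hne).isEmbedding
    rw [← hemb.isSimplyConnected_image]
    have himage : (fun c : ℂ => q + c • (p - q)) '' lineSlice D p q = D ∩ cline q (p - q) := by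
      ext x
      constructor
      · rintro ⟨c, hc, rfl⟩
        exact ⟨hc, c, rfl⟩
      · rintro ⟨hx, c, rfl⟩
        exact ⟨c, hx, rfl⟩
    rw [himage]
    exact (hcc q (p - q) hne ⟨q, hq, 0, by simp⟩).2

theorem bddAbove_caraMetric {n : ℕ} {D : Set (Cn n)} (hD : IsOpen D) {z : Cn n} (hz : z ∈ D)
    (Y : Cn n) :
    BddAbove {r : ℝ | ∃ f : Cn n → ℂ, DifferentiableOn ℂ f D ∧ MapsTo f D (ball (0:ℂ) 1) ∧
      f z = 0 ∧ r = ‖fderiv ℂ f z Y‖} := by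
  have hopen : IsOpen {t : ℂ | z + t • Y ∈ D} :=
    hD.preimage (f := fun t : ℂ => z + t • Y) (by fun_prop)
  obtain ⟨R, hR, hsub⟩ := nhds_basis_closedBall.mem_iff.1
    (hopen.mem_nhds (show (0 : ℂ) ∈ _ by simpa using hz))
  refine ⟨1 / R, ?_⟩
  rintro r ⟨f, hf, hmaps, -, rfl⟩
  have hline : ∀ t : ℂ, HasDerivAt (fun t : ℂ => z + t • Y) Y t := fun t => by
    simpa using ((hasDerivAt_id t).smul_const Y).const_add z
  have hderiv : HasDerivAt (fun t : ℂ => f (z + t • Y)) (fderiv ℂ f z Y) 0 := by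
    have hfz : HasFDerivAt f (fderiv ℂ f z) (z + (0 : ℂ) • Y) := by
      simpa using (hf.differentiableAt (hD.mem_nhds hz)).hasFDerivAt
    exact hfz.comp_hasDerivAt (0 : ℂ) (hline 0)
  rw [← hderiv.deriv]
  have hdiff : DifferentiableOn ℂ (fun t : ℂ => f (z + t • Y)) {t : ℂ | z + t • Y ∈ D} :=
    hf.comp (fun t _ => (hline t).differentiableAt.differentiableWithinAt) fun t ht => ht
  refine Complex.norm_deriv_le_of_forall_mem_sphere_norm_le hR (hdiff.diffContOnCl_ball hsub) ?_
  intro t ht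
  exact (mem_ball_zero_iff.1 (hmaps (hsub (sphere_subset_closedBall ht)))).le

theorem le_caraMetric_of_notMem {n : ℕ} {D : Set (Cn n)} (hD : IsOpen D) (hcc : IsCConvex D)
    {z Y : Cn n} (hz : z ∈ D) {l : ℂ} (hl : z + l • Y ∉ D) :
    1 / (32 * ‖l‖) ≤ caraMetric D z Y := by
  obtain ⟨f, hf, hmaps, hfz, hle⟩ :=
    exists_mapsTo_ball_of_notMem hD hcc.lineSimplyConnected hz hl
  exact hle.trans (le_csSup (bddAbove_caraMetric hD hz Y) ⟨f, hf, hmaps, hfz, rfl⟩)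

/-- Near a boundary point `a` and a direction `X ∉ L_a`, complex lines leave `D` quickly. -/
theorem eventually_exists_notMem {n : ℕ} {D : Set (Cn n)} (hD : IsOpen D) (hne : D.Nonempty)
    (hcc : IsCConvex D) {a X : Cn n} (ha : a ∉ D) (hX : X ∉ La D a) {δ : ℝ} (hδ : 0 < δ) :
    ∀ᶠ x : Cn n × Cn n in nhds (a, X), ∃ l : ℂ, ‖l‖ < δ ∧ x.1 + l • x.2 ∉ D := by
  obtain ⟨ℓ, hℓ⟩ := exists_linearMap_ne_zero_of_notMem hD hne hcc.lineSimplyConnected ha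
  by_cases hℓX : ℓ X = 0
  · have hex : ∃ l : ℂ, ‖l‖ < δ ∧ a + l • X ∉ frontier D := by
      by_contra! hcon
      exact hX ⟨δ, hδ, hcon⟩
    obtain ⟨l, hl, hfr⟩ := hex
    have hnD : a + l • X ∉ D := fun h => hℓ _ h (by simp [hℓX])
    have hncl : a + l • X ∉ closure D := fun h => hfr ⟨h, fun hi => hnD (interior_subset hi)⟩
    have hc : ContinuousAt (fun x : Cn n × Cn n => x.1 + l • x.2) (a, X) := by fun_prop
    filter_upwards [hc (isClosed_closure.isOpen_compl.mem_nhds hncl)] with x hx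
    exact ⟨l, hl, fun h => hx (subset_closure h)⟩
  · have hc1 : ContinuousAt (fun x : Cn n × Cn n => ℓ (x.1 - a)) (a, X) := by fun_prop
    have hc2 : ContinuousAt (fun x : Cn n × Cn n => ℓ x.2) (a, X) := by fun_prop
    have hc : ContinuousAt (fun x : Cn n × Cn n => -(ℓ (x.1 - a) / ℓ x.2)) (a, X) :=
      (hc1.div hc2 (show ℓ (a, X).2 ≠ 0 from hℓX)).neg
    have h0 : ball (0 : ℂ) δ ∈ nhds (-(ℓ ((a, X).1 - a) / ℓ (a, X).2)) := by
      simpa using ball_mem_nhds (0 : ℂ) hδ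
    filter_upwards [hc h0, hc2.eventually_ne hℓX] with x hx hx2
    refine ⟨-(ℓ (x.1 - a) / ℓ x.2), mem_ball_zero_iff.1 hx, fun h => hℓ _ h ?_⟩
    simp only [map_sub, map_add, map_smul, smul_eq_mul]
    field_simp
    ring

/-- For a boundary point `a` of a ℂ-convex domain `D`,
`γ_D(z;X) → ∞` as `z → a`, locally uniformly in `X ∉ L_a`. -/
theorem statement2 {n : ℕ} (D : Set (Cn n)) (hD : IsDomain' D) (hcc : IsCConvex D)
    (a : Cn n) (ha : a ∈ frontier D) :
    ∀ M > (0:ℝ), ∀ X : Cn n, X ∉ La D a →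
      ∃ U ∈ nhds a, ∃ V ∈ nhds X,
        ∀ z ∈ D ∩ U, ∀ Y ∈ V \ La D a, M < caraMetric D z Y := by
  intro M hM X hX
  have haD : a ∉ D := fun h => ha.2 (hD.1.interior_eq.symm ▸ h)
  have hev := eventually_exists_notMem hD.1 hD.2.nonempty hcc haD hX
    (δ := 1 / (32 * M)) (by positivity)
  obtain ⟨U, hU, V, hV, hUV⟩ := mem_nhds_prod_iff.1 hev
  refine ⟨U, hU, V, hV, fun z hz Y hY => ?_⟩
  obtain ⟨l, hl, hlD⟩ := hUV (mk_mem_prod hz.2 hY.1)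
  refine lt_of_lt_of_le ?_ (le_caraMetric_of_notMem hD.1 hcc hz.1 hlD)
  have hlpos : 0 < ‖l‖ := norm_pos_iff.2 fun h => hlD (by simpa [h] using hz.1)
  rw [lt_div_iff₀ (by positivity)] at hl ⊢
  linarith

end
end

section
/- Let a be a boundary point of a ℂ-convex domain D ⊆ ℂ^n and assume that ∂D is C¹-smooth at a. Then L_a is a complex linear subspace of ℂ^n. -/
open Complex Metric Set MeasureTheory

noncomputable section

/-- Along a path whose exponential stays in a set carrying a continuous branch `F` of the
logarithm, the increments of `F ∘ exp` agree with those of the path. -/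
theorem log_branch_increment {T : Set ℂ} {F : ℂ → ℂ} (hF : ContinuousOn F T)
    (hexp : ∀ z ∈ T, Complex.exp (F z) = z) {u : unitInterval → ℂ} (hu : Continuous u)
    (huT : ∀ s, Complex.exp (u s) ∈ T) :
    F (Complex.exp (u 1)) - F (Complex.exp (u 0)) = u 1 - u 0 := by
  have hG : Continuous fun s => F (Complex.exp (u s)) - F (Complex.exp (u 0)) + u 0 := by
    have : Continuous fun s => F (Complex.exp (u s)) :=
      hF.comp_continuous (Complex.continuous_exp.comp hu) huT
    exact (this.sub continuous_const).add continuous_const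
  have h := Complex.isCoveringMap_exp.eq_of_comp_eq hG hu (by
    ext s
    simp [Complex.exp_add, Complex.exp_sub, hexp _ (huT s), hexp _ (huT 0)]) 0 (by simp)
  have h1 := congrFun h 1
  linear_combination h1

/-- There is no `2π`-periodic open family of simply connected plane domains avoiding the origin
and containing both `1` and the rotating point `t * exp (-iθ)`. -/
theorem not_exists_rotating_family (T : ℝ → Set ℂ)
    (hopen : IsOpen {p : ℝ × ℂ | p.2 ∈ T p.1}) (hsc : ∀ θ, IsSimplyConnected (T θ))
    (h0 : ∀ θ, (0 : ℂ) ∉ T θ) (h1 : ∀ θ, (1 : ℂ) ∈ T θ) (t : ℂ)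
    (ht : ∀ θ : ℝ, t * Complex.exp (-(θ * Complex.I)) ∈ T θ)
    (hper : T (2 * Real.pi) = T 0) : False := by
  have hTo : ∀ θ, IsOpen (T θ) := fun θ =>
    hopen.preimage (f := fun z : ℂ => (θ, z)) (by fun_prop)
  have hbranch : ∀ θ, ∃ F : ℂ → ℂ, ContinuousOn F (T θ) ∧ ∀ z ∈ T θ, Complex.exp (F z) = z := by
    intro θ
    obtain ⟨F, hF, hF'⟩ := Complex.exists_continuousOn_eqOn_exp_comp (hsc θ) (hTo θ)
      (g := fun z => z) continuousOn_id (by simpa using h0 θ)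
    exact ⟨F, hF, fun z hz => hF' hz⟩
  have huniq : ∀ θ (F G : ℂ → ℂ), ContinuousOn F (T θ) → (∀ z ∈ T θ, Complex.exp (F z) = z) →
      ContinuousOn G (T θ) → (∀ z ∈ T θ, Complex.exp (G z) = z) → ∀ z ∈ T θ,
      F z - F 1 = G z - G 1 := by
    intro θ F G hF hF' hG hG' z hz
    obtain ⟨γ, hγ⟩ := (hsc θ).isPathConnected.joinedIn 1 (h1 θ) z hz
    have := log_branch_increment hG hG' (u := fun s => F (γ s))
      (hF.comp_continuous γ.continuous hγ) (fun s => by rw [hF' _ (hγ s)]; exact hγ s)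
    rw [hF' _ (hγ 1), hF' _ (hγ 0), γ.source, γ.target] at this
    exact this.symm
  choose F hF hF' using hbranch
  set h : ℝ → ℂ := fun θ =>
    F θ (t * Complex.exp (-(θ * Complex.I))) - F θ 1 + θ * Complex.I with hh
  have hloc : IsLocallyConstant h := by
    rw [IsLocallyConstant.iff_eventually_eq]
    intro θ₀
    obtain ⟨γ, hγ⟩ := (hsc θ₀).isPathConnected.joinedIn 1 (h1 θ₀) _ (ht θ₀)
    have hcF : Continuous fun s => F θ₀ (γ s) :=
      (hF θ₀).comp_continuous γ.continuous hγ
    have hev : ∀ᶠ θ : ℝ in nhds θ₀, ∀ s ∈ (univ : Set unitInterval),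
        Complex.exp (F θ₀ (γ s) - F θ₀ 1 - ((s : ℝ) * (θ - θ₀) : ℝ) * Complex.I) ∈ T θ := by
      refine isCompact_univ.eventually_forall_of_forall_eventually
        (P := fun (θ : ℝ) (s : unitInterval) =>
          Complex.exp (F θ₀ (γ s) - F θ₀ 1 - ((s : ℝ) * (θ - θ₀) : ℝ) * Complex.I) ∈ T θ)
        fun s _ => ?_
      have hc : Continuous fun z : ℝ × unitInterval => (z.1,
          Complex.exp (F θ₀ (γ z.2) - F θ₀ 1 - ((z.2 : ℝ) * (z.1 - θ₀) : ℝ) * Complex.I)) := by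
        have : Continuous fun z : ℝ × unitInterval => F θ₀ (γ z.2) := hcF.comp continuous_snd
        refine continuous_fst.prodMk (Complex.continuous_exp.comp
          ((this.sub continuous_const).sub ?_))
        fun_prop
      refine hc.continuousAt.eventually_mem (hopen.mem_nhds ?_)
      simp [Complex.exp_sub, hF' θ₀ _ (hγ s), hF' θ₀ _ (h1 θ₀), hγ s]
    filter_upwards [hev] with θ hθ
    have := log_branch_increment (hF θ) (hF' θ)
      (u := fun s => F θ₀ (γ s) - F θ₀ 1 - ((s : ℝ) * (θ - θ₀) : ℝ) * Complex.I)
      ((hcF.sub continuous_const).sub (by fun_prop)) (fun s => hθ s (mem_univ s))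
    have e1 : Complex.exp (F θ₀ (γ 1) - F θ₀ 1 - (((1 : unitInterval) : ℝ) * (θ - θ₀) : ℝ) *
        Complex.I) = t * Complex.exp (-(θ * Complex.I)) := by
      rw [Complex.exp_sub, Complex.exp_sub, hF' θ₀ _ (hγ 1), hF' θ₀ _ (h1 θ₀), γ.target, div_one,
        div_eq_mul_inv, mul_assoc, ← Complex.exp_neg, ← Complex.exp_add]
      congr 2
      push_cast
      simp
      ring
    have e0 : Complex.exp (F θ₀ (γ 0) - F θ₀ 1 - (((0 : unitInterval) : ℝ) * (θ - θ₀) : ℝ) *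
        Complex.I) = 1 := by
      simp
    rw [e1, e0, γ.target, γ.source] at this
    simp only [hh]
    push_cast at this
    linear_combination this
  have hend : h (2 * Real.pi) = h 0 := hloc.apply_eq_of_preconnectedSpace _ _
  have hmem : t ∈ T 0 := by simpa using ht 0
  have hFF := huniq 0 (F (2 * Real.pi)) (F 0) (hper ▸ hF _) (hper ▸ hF' _) (hF 0) (hF' 0) t hmem
  simp [hh, Complex.exp_neg, hFF] at hend

/-- At a boundary point where the defining function is differentiable with nonzero real
differential, the complex tangent space does not meet a ℂ-convex domain. -/
theorem IsCConvex.add_notMem_of_forall_smul_eq_zero {n : ℕ} {D : Set (Cn n)} (hD : IsOpen D)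
    (hcc : IsCConvex D) {b : Cn n} (hb : b ∉ D) {r : Cn n → ℝ} {L : Cn n →L[ℝ] ℝ}
    (hr : HasFDerivAt r L b) (hrb : r b = 0) (hL : L ≠ 0)
    (hneg : ∀ᶠ x in nhds b, r x < 0 → x ∈ D) {Z : Cn n} (hZ : ∀ c : ℂ, L (c • Z) = 0) :
    b + Z ∉ D := by
  intro hbZ
  obtain ⟨ν, hν⟩ : ∃ ν, L ν = -1 := by
    obtain ⟨v, hv⟩ : ∃ v, L v ≠ 0 := by
      by_contra! h
      exact hL (ContinuousLinearMap.ext h)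
    exact ⟨(-(L v)⁻¹) • v, by simp [hv]⟩
  obtain ⟨ε, hε, hεD⟩ : ∃ ε > (0 : ℝ), ∀ c : ℂ, ‖c‖ ≤ ε → b + (Z + c • ν) ∈ D := by
    have hc : Continuous fun c : ℂ => b + (Z + c • ν) := by fun_prop
    have := (hc.tendsto 0).eventually_mem (hD.mem_nhds (by simpa using hbZ))
    obtain ⟨ε, hε, h⟩ := Metric.eventually_nhds_iff_ball.1 this
    exact ⟨ε / 2, by positivity, fun c hc => h c (by simpa using by linarith)⟩
  set M : ℝ := ‖Z‖ + ε * ‖ν‖ + 1 with hM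
  have hMpos : 0 < M := by positivity
  have hlo := (Asymptotics.isLittleO_iff.1 hr.isLittleO) (c := ε / (2 * M)) (by positivity)
  obtain ⟨δ, hδ, hball⟩ := Metric.eventually_nhds_iff_ball.1 (hlo.and hneg)
  obtain ⟨t, ht0, htδ⟩ : ∃ t : ℝ, 0 < t ∧ t * M < δ :=
    ⟨δ / (2 * M), by positivity, by field_simp; linarith⟩
  set V : ℝ → Cn n := fun θ => Z + ((ε : ℂ) * Complex.exp (θ * Complex.I)) • ν with hV
  have hV1 : ∀ θ, b + V θ ∈ D := fun θ =>
    hεD _ (by simp [Complex.norm_exp_ofReal_mul_I, abs_of_pos hε])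
  have hV0 : ∀ θ, V θ ≠ 0 := fun θ h => hb (by simpa [h] using hV1 θ)
  refine not_exists_rotating_family (fun θ => {l : ℂ | b + l • V θ ∈ D}) ?_ ?_ ?_ ?_ t ?_ ?_
  · exact hD.preimage (f := fun p : ℝ × ℂ => b + p.2 • V p.1) (by fun_prop)
  · intro θ
    have hemb : Topology.IsEmbedding fun l : ℂ => b + l • V θ :=
      (Homeomorph.addLeft b).isEmbedding.comp
        (isClosedEmbedding_smul_left (hV0 θ)).isEmbedding
    have himg : (fun l : ℂ => b + l • V θ) '' {l : ℂ | b + l • V θ ∈ D} = D ∩ cline b (V θ) := by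
      ext w
      constructor
      · rintro ⟨l, hl, rfl⟩
        exact ⟨hl, l, rfl⟩
      · rintro ⟨hw, l, rfl⟩
        exact ⟨l, hw, rfl⟩
    rw [← hemb.isSimplyConnected_image, himg]
    exact (hcc b (V θ) (hV0 θ) ⟨b + V θ, hV1 θ, 1, by simp⟩).2
  · intro θ
    simpa using hb
  · intro θ
    simpa using hV1 θ
  · intro θ
    set e : ℂ := Complex.exp (-(θ * Complex.I)) with he
    have hne : ‖e‖ = 1 := by
      have : e = Complex.exp ((-θ : ℝ) * Complex.I) := by rw [he]; push_cast; ring_nf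
      rw [this, Complex.norm_exp_ofReal_mul_I]
    have hee : e * Complex.exp (θ * Complex.I) = 1 := by
      rw [he, ← Complex.exp_add]; simp
    set k : Cn n := e • Z + ε • ν with hk
    have hvec : ((t : ℂ) * e) • V θ = t • k := by
      simp only [hV, hk]
      rw [mul_smul, ← Complex.coe_smul t, ← Complex.coe_smul ε, smul_add, smul_smul e]
      rw [show e * ((ε : ℂ) * Complex.exp (θ * Complex.I)) = ε by
        linear_combination (ε : ℂ) * hee]
    have hkM : ‖k‖ ≤ M := by
      have : ‖k‖ ≤ ‖e • Z‖ + ‖ε • ν‖ := norm_add_le _ _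
      rw [norm_smul, norm_smul, hne, Real.norm_of_nonneg hε.le] at this
      linarith
    have hnorm : ‖t • k‖ ≤ t * M := by
      rw [norm_smul, Real.norm_of_nonneg ht0.le]
      gcongr
    have hLk : L (t • k) = -(t * ε) := by
      simp [hk, hZ e, hν]
    obtain ⟨hsmall, himp⟩ := hball (b + t • k) (by simpa using hnorm.trans_lt htδ)
    change b + ((t : ℂ) * e) • V θ ∈ D
    rw [hvec]
    refine himp ?_
    rw [add_sub_cancel_left, hrb, hLk, Real.norm_eq_abs] at hsmall
    have h2 : ε / (2 * M) * ‖t • k‖ ≤ t * ε / 2 := by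
      calc ε / (2 * M) * ‖t • k‖ ≤ ε / (2 * M) * (t * M) := by gcongr
        _ = t * ε / 2 := by field_simp
    have h3 := (abs_le.1 hsmall).2
    nlinarith [mul_pos ht0 hε]
  · simp [hV]

/-- A vector all of whose small complex multiples, based at `a`, stay in the zero set of `r`
is annihilated by every complex functional whose real part is the differential of `r`. -/
theorem functional_eq_zero_of_eventually_zero {n : ℕ} {r : Cn n → ℝ} {a X : Cn n}
    {L : Cn n →L[ℝ] ℝ} (hr : HasFDerivAt r L a) {ℓ : Cn n →ₗ[ℂ] ℂ} (hℓ : ∀ v, (ℓ v).re = L v)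
    (hX : ∀ᶠ l : ℂ in nhds 0, r (a + l • X) = 0) : ℓ X = 0 := by
  have key : ∀ c : ℂ, L (c • X) = 0 := by
    intro c
    have hline : HasDerivAt (fun s : ℝ => a + s • (c • X)) (c • X) 0 := by
      simpa using ((hasDerivAt_id (0 : ℝ)).smul_const (c • X)).const_add a
    have h1 : HasDerivAt (fun s : ℝ => r (a + s • (c • X))) (L (c • X)) 0 := by
      have hr' : HasFDerivAt r L (a + (0 : ℝ) • (c • X)) := by simpa using hr
      exact hr'.comp_hasDerivAt 0 hline
    have hc : Continuous fun s : ℝ => (s : ℂ) * c := by fun_prop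
    have h2 : (fun s : ℝ => r (a + s • (c • X))) =ᶠ[nhds 0] fun _ => 0 := by
      filter_upwards [(hc.tendsto' 0 0 (by simp)).eventually hX] with s hs
      rwa [mul_smul, Complex.coe_smul] at hs
    exact h1.unique ((hasDerivAt_const (0 : ℝ) (0 : ℝ)).congr_of_eventuallyEq h2)
  apply Complex.ext
  · simpa [hℓ] using key 1
  · have := key (-Complex.I)
    rw [← hℓ, map_smul] at this
    simpa using this

/-- If a complex hyperplane through the point with coordinates `(x, y)` misses `D`, it meets one
of the coordinate axes at a point whose coordinate is at most `‖x‖ + ‖y‖`. -/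
theorem exists_axis_point_notMem {n : ℕ} {D : Set (Cn n)} {c X Y : Cn n} {x y : ℂ}
    {ℓ : Cn n →ₗ[ℂ] ℂ} (hℓ : ∀ Z, ℓ Z = 0 → c + (x • X + y • Y) + Z ∉ D) :
    ∃ z : ℂ, ‖z‖ ≤ ‖x‖ + ‖y‖ ∧ (c + z • X ∉ D ∨ c + z • Y ∉ D) := by
  have aux : ∀ (X Y : Cn n) (x y : ℂ), (∀ Z, ℓ Z = 0 → c + (x • X + y • Y) + Z ∉ D) →
      ‖ℓ Y‖ ≤ ‖ℓ X‖ → ∃ z : ℂ, ‖z‖ ≤ ‖x‖ + ‖y‖ ∧ c + z • X ∉ D := by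
    intro X Y x y h hle
    set q := ℓ Y / ℓ X with hq
    have hq1 : ‖q‖ ≤ 1 := by
      rw [hq, norm_div]
      exact div_le_one_of_le₀ hle (norm_nonneg _)
    have hqX : q * ℓ X = ℓ Y := by
      by_cases h0 : ℓ X = 0
      · have : ℓ Y = 0 := by simpa [h0] using hle
        simp [h0, this]
      · exact div_mul_cancel₀ _ h0
    refine ⟨x + y * q, ?_, ?_⟩
    · calc ‖x + y * q‖ ≤ ‖x‖ + ‖y * q‖ := norm_add_le _ _
        _ ≤ ‖x‖ + ‖y‖ := by
          rw [norm_mul]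
          gcongr
          exact mul_le_of_le_one_right (norm_nonneg _) hq1
    · have := h ((y * q) • X - y • Y) (by
        simp only [map_sub, map_smul, smul_eq_mul]
        linear_combination y * hqX)
      convert this using 2
      module
  rcases le_total ‖ℓ Y‖ ‖ℓ X‖ with hle | hle
  · obtain ⟨z, hz, hz'⟩ := aux X Y x y hℓ hle
    exact ⟨z, hz, Or.inl hz'⟩
  · obtain ⟨z, hz, hz'⟩ := aux Y X y x (by simpa [add_comm (y • Y)] using hℓ) hle
    exact ⟨z, by linarith, Or.inr hz'⟩

/-- Near a point of strict differentiability, the zero set of `r` moves into `{r < 0}` when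
translated by a small positive multiple of a direction in which `r` decreases. -/
theorem eventually_add_smul_neg {n : ℕ} {r : Cn n → ℝ} {a ν : Cn n} {L : Cn n →L[ℝ] ℝ}
    (hr : HasStrictFDerivAt r L a) (hν : L ν < 0) :
    ∃ δ > (0 : ℝ), ∀ p ∈ ball a δ, r p = 0 → ∀ t : ℝ, 0 < t → t < δ → r (p + t • ν) < 0 := by
  have hν0 : 0 < ‖ν‖ := norm_pos_iff.2 fun h => by simp [h] at hν
  have hlo := (Asymptotics.isLittleO_iff.1 hr.isLittleO) (c := -L ν / (2 * ‖ν‖))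
    (div_pos (neg_pos.2 hν) (by positivity))
  have hc : Continuous fun z : Cn n × ℝ => (z.1 + z.2 • ν, z.1) := by fun_prop
  obtain ⟨δ, hδ, hball⟩ := Metric.eventually_nhds_iff_ball.1
    ((hc.tendsto' (a, 0) (a, a) (by simp)).eventually hlo)
  refine ⟨δ, hδ, fun p hp hrp t ht htδ => ?_⟩
  have h := hball (p, t) (by
    rw [← ball_prod_same]
    exact ⟨hp, by simpa [abs_of_pos ht] using htδ⟩)
  simp only [hrp, add_sub_cancel_left, map_smul, smul_eq_mul, norm_smul, Real.norm_eq_abs,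
    abs_of_pos ht, sub_zero] at h
  have h2 : -L ν / (2 * ‖ν‖) * (t * ‖ν‖) = -(t * L ν) / 2 := by field_simp
  rw [h2] at h
  have h3 := (abs_le.1 h).2
  nlinarith [mul_pos ht (neg_pos.2 hν)]

/-- If the boundary of a ℂ-convex domain `D` is `C¹`-smooth at
`a ∈ ∂D` (with defining function `r`), then `L_a` is a complex linear subspace. -/
theorem statement3 {n : ℕ} (D : Set (Cn n)) (hD : IsDomain' D) (hcc : IsCConvex D)
    (a : Cn n) (ha : a ∈ frontier D)
    (U : Set (Cn n)) (hU : IsOpen U) (haU : a ∈ U) (r : Cn n → ℝ)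
    (hr : ContDiffOn ℝ 1 r U) (hgrad : ∀ x ∈ U, fderiv ℝ r x ≠ 0)
    (hsub : D ∩ U = {x ∈ U | r x < 0})
    (hbd : frontier D ∩ U = {x ∈ U | r x = 0}) :
    ∃ S : Submodule ℂ (Cn n), La D a = ↑S := by
  have hDo := hD.1
  have hfD : ∀ b ∈ frontier D, b ∉ D := fun b hb =>
    (hDo.frontier_eq ▸ hb : b ∈ closure D \ D).2
  have hzero : ∀ b ∈ frontier D, b ∈ U → r b = 0 := fun b hb hbU =>
    (hbd ▸ (⟨hb, hbU⟩ : b ∈ frontier D ∩ U) : b ∈ {x ∈ U | r x = 0}).2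
  have hmemD : ∀ x ∈ U, r x < 0 → x ∈ D := fun x hx hrx =>
    (hsub ▸ (⟨hx, hrx⟩ : x ∈ {x ∈ U | r x < 0}) : x ∈ D ∩ U).1
  have hderiv : ∀ b ∈ U, HasStrictFDerivAt r (fderiv ℝ r b) b := fun b hb =>
    (hr.contDiffAt (hU.mem_nhds hb)).hasStrictFDerivAt one_ne_zero
  have htangent : ∀ b ∈ frontier D, b ∈ U → ∃ ℓ : Cn n →ₗ[ℂ] ℂ,
      (∀ v, (ℓ v).re = fderiv ℝ r b v) ∧ ∀ Z, ℓ Z = 0 → b + Z ∉ D := by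
    intro b hb hbU
    have hre : ∀ v, (Module.Dual.extendRCLike (𝕜 := ℂ)
        (fderiv ℝ r b).toLinearMap v).re = fderiv ℝ r b v := fun v =>
      Module.Dual.re_extendRCLike_apply (𝕜 := ℂ) (fderiv ℝ r b).toLinearMap v
    refine ⟨Module.Dual.extendRCLike (fderiv ℝ r b).toLinearMap, hre, fun Z hZ => ?_⟩
    refine hcc.add_notMem_of_forall_smul_eq_zero hDo (hfD b hb) (hderiv b hbU).hasFDerivAt
      (hzero b hb hbU) (hgrad b hbU) ?_ fun c => ?_
    · filter_upwards [hU.mem_nhds hbU] with x hx using hmemD x hx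
    · rw [← hre, map_smul, hZ, smul_zero, Complex.zero_re]
  have hLa : ∀ X ∈ La D a, ∀ᶠ l : ℂ in nhds 0, a + l • X ∈ frontier D := by
    rintro X ⟨ε, hε, h⟩
    exact Metric.eventually_nhds_iff_ball.2 ⟨ε, hε, fun l hl => h l (by simpa using hl)⟩
  obtain ⟨ν, hν⟩ : ∃ ν, fderiv ℝ r a ν < 0 := by
    by_contra! h
    refine hgrad a haU (ContinuousLinearMap.ext fun v => ?_)
    have := h (-v)
    rw [map_neg] at this
    exact le_antisymm (neg_nonneg.1 this) (h v)
  obtain ⟨δ, hδ, hshift⟩ := eventually_add_smul_neg (hderiv a haU) hν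
  have hdisc : ∀ X ∈ La D a, ∃ η > (0 : ℝ), ∀ x : ℂ, ‖x‖ < η → ∀ t : ℝ, 0 < t → t < η →
      a + t • ν + x • X ∈ D := by
    intro X hX
    have hc : Continuous fun x : ℂ => a + x • X := by fun_prop
    have hc' : Continuous fun z : ℂ × ℝ => a + z.2 • ν + z.1 • X := by fun_prop
    have e1 : ∀ᶠ z : ℂ × ℝ in nhds (0, 0), a + z.1 • X ∈ frontier D ∧
        a + z.1 • X ∈ U ∩ ball a δ :=
      Filter.Tendsto.eventually (continuous_fst.tendsto' (0, 0) 0 rfl) ((hLa X hX).and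
        ((hc.tendsto' 0 a (by simp)).eventually_mem
          ((hU.inter isOpen_ball).mem_nhds ⟨haU, mem_ball_self hδ⟩)))
    have e2 : ∀ᶠ z : ℂ × ℝ in nhds (0, 0), a + z.2 • ν + z.1 • X ∈ U :=
      (hc'.tendsto' (0, 0) a (by simp)).eventually_mem (hU.mem_nhds haU)
    obtain ⟨η, hη, hball⟩ := Metric.eventually_nhds_iff_ball.1 (e1.and e2)
    refine ⟨min η δ, lt_min hη hδ, fun x hx t ht htη => ?_⟩
    obtain ⟨⟨hfr, hxU, hxδ⟩, hU'⟩ := hball (x, t) (by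
      rw [← ball_prod_same]
      exact ⟨by simpa using hx.trans_le (min_le_left _ _),
        by simpa [abs_of_pos ht] using htη.trans_le (min_le_left _ _)⟩)
    refine hmemD _ hU' ?_
    have := hshift _ hxδ (hzero _ hfr hxU) t ht (htη.trans_le (min_le_right _ _))
    rwa [add_right_comm] at this
  refine ⟨{ carrier := La D a, add_mem' := ?_, zero_mem' := ?_, smul_mem' := ?_ }, rfl⟩
  · intro X Y hX hY
    obtain ⟨ηX, hηX, hDX⟩ := hdisc X hX
    obtain ⟨ηY, hηY, hDY⟩ := hdisc Y hY
    have hc : Continuous fun z : ℂ × ℝ => a + z.2 • ν + (z.1 • X + z.1 • Y) := by fun_prop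
    obtain ⟨ηU, hηU, hUball⟩ := Metric.eventually_nhds_iff_ball.1
      ((hc.tendsto' (0, 0) a (by simp)).eventually_mem (hU.mem_nhds haU))
    obtain ⟨η, hη, hη1, hη2, hη3⟩ : ∃ η > (0 : ℝ), η ≤ ηX ∧ η ≤ ηY ∧ η ≤ ηU :=
      ⟨min (min ηX ηY) ηU, by positivity, (min_le_left _ _).trans (min_le_left _ _),
        (min_le_left _ _).trans (min_le_right _ _), min_le_right _ _⟩
    have hin : ∀ l : ℂ, ‖l‖ < η / 2 → ∀ t : ℝ, 0 < t → t < η →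
        a + t • ν + (l • X + l • Y) ∈ D := by
      intro l hl t ht htη
      by_contra hnot
      let γ : unitInterval → Cn n := fun s =>
        a + t • ν + ((((s : ℝ) : ℂ) * l) • X + (((s : ℝ) : ℂ) * l) • Y)
      have hγ : Continuous γ := by fun_prop
      have hγ0 : γ 0 ∈ D := by simpa [γ] using hDX 0 (by simpa using hηX) t ht (by linarith)
      have hγ1 : γ 1 ∉ D := by simpa [γ] using hnot
      obtain ⟨s, hs⟩ := nonempty_frontier_iff (s := γ ⁻¹' D).2
        ⟨⟨0, hγ0⟩, fun h => hγ1 (eq_univ_iff_forall.1 h 1)⟩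
      have hsf : γ s ∈ frontier D := hγ.frontier_preimage_subset D hs
      have hsl : ‖((s : ℝ) : ℂ) * l‖ ≤ ‖l‖ := by
        rw [norm_mul, Complex.norm_of_nonneg s.2.1]
        exact mul_le_of_le_one_left (norm_nonneg _) s.2.2
      have hsU : γ s ∈ U := hUball (((s : ℝ) : ℂ) * l, t) (by
        rw [← ball_prod_same]
        exact ⟨by simpa only [mem_ball_zero_iff] using by linarith,
          by simpa [abs_of_pos ht] using by linarith⟩)
      obtain ⟨ℓ, -, hℓ⟩ := htangent _ hsf hsU
      obtain ⟨z, hz, hzX | hzY⟩ := exists_axis_point_notMem hℓ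
      · exact hzX (hDX z (by linarith) t ht (by linarith))
      · exact hzY (hDY z (by linarith) t ht (by linarith))
    refine ⟨η / 2, by positivity, fun l hl => ?_⟩
    rw [hDo.frontier_eq, smul_add]
    constructor
    · have hct : Continuous fun t : ℝ => a + t • ν + (l • X + l • Y) := by fun_prop
      have hlim : Filter.Tendsto (fun t : ℝ => a + t • ν + (l • X + l • Y))
          (nhdsWithin 0 (Ioi 0)) (nhds (a + (l • X + l • Y))) :=
        (hct.tendsto' 0 _ (by simp)).mono_left nhdsWithin_le_nhds
      refine mem_closure_of_tendsto hlim ?_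
      filter_upwards [Ioo_mem_nhdsGT hη] with t ht using hin l hl t ht.1 ht.2
    · obtain ⟨ℓ, hre, hℓ⟩ := htangent a ha haU
      have hker : ∀ W ∈ La D a, ℓ W = 0 := by
        intro W hW
        have hcW : Continuous fun x : ℂ => a + x • W := by fun_prop
        refine functional_eq_zero_of_eventually_zero (hderiv a haU).hasFDerivAt hre ?_
        filter_upwards [hLa W hW, (hcW.tendsto' 0 a (by simp)).eventually_mem
          (hU.mem_nhds haU)] with x hx hxU using hzero _ hx hxU
      exact hℓ _ (by simp [hker X hX, hker Y hY])
  · exact ⟨1, one_pos, fun l _ => by simpa using ha⟩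
  · rintro c X ⟨ε, hε, h⟩
    refine ⟨ε / (‖c‖ + 1), by positivity, fun l hl => ?_⟩
    rw [smul_smul]
    refine h _ ?_
    rw [norm_mul]
    calc ‖l‖ * ‖c‖ ≤ ‖l‖ * (‖c‖ + 1) := by gcongr; linarith
      _ < ε := (lt_div_iff₀ (by positivity)).1 hl


end
end

section
/- Let a be a C^∞-smooth boundary point of a ℂ-convex domain D ⊆ ℂ^n and let X ∈ ℂ^n be a nonzero vector with finite line type l_{a,X} < ∞. Let n_a denote the inner normal line to ∂D at a. Then there exist a neighborhood U of a and a constant c > 1 such that c^{-1}·d_D(z) ≤ d_D(z,X)^{l_{a,X}} ≤ c·d_D(z) for all z ∈ D ∩ U ∩ n_a, where d_D(z) is the Euclidean distance from z to ∂D. -/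
open Complex Metric Set MeasureTheory

noncomputable section

/-- A continuous function on a preconnected set whose exponential is constant is itself
constant. -/
theorem IsPreconnected.eq_of_exp_comp_eq {α : Type*} [TopologicalSpace α] {S : Set α}
    (hS : IsPreconnected S) {f : α → ℂ} (hf : ContinuousOn f S) {c : ℂ}
    (hc : ∀ x ∈ S, exp (f x) = c) {x y : α} (hx : x ∈ S) (hy : y ∈ S) : f x = f y :=
  isCoveringMap_exp.constOn_of_comp hS hf
    (fun a ha b hb => Subtype.ext ((hc a ha).trans (hc b hb).symm)) hx hy

/-- In a family of simply connected planar sets avoiding `0`, open in the total space and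
parametrised by a circle, two sections cannot wind differently around `0`. -/
theorem not_isSimplyConnected_fibers {E : Set (ℂ × ℂ)} (hE : IsOpen E) {ρ : ℝ} (hρ : 0 < ρ)
    (hsc : ∀ η : ℂ, ‖η‖ = ρ → IsSimplyConnected {u | (η, u) ∈ E})
    (h0 : ∀ η : ℂ, ‖η‖ = ρ → (η, (0 : ℂ)) ∉ E) {p q : ℂ}
    (hp : ∀ η : ℂ, ‖η‖ = ρ → (η, p) ∈ E) (hq : ∀ η : ℂ, ‖η‖ = ρ → (η, q / η) ∈ E) : False := by
  have hopen (η : ℂ) : IsOpen {u | (η, u) ∈ E} := hE.preimage (by fun_prop)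
  have hlog (η : ℂ) (hη : ‖η‖ = ρ) : ∃ L : ℂ → ℂ, ContinuousOn L {u | (η, u) ∈ E} ∧
      EqOn (exp ∘ L) id {u | (η, u) ∈ E} :=
    exists_continuousOn_eqOn_exp_comp (hsc η hη) (hopen η) continuousOn_id
      (by simpa using h0 η hη)
  choose! L hLc hLe using hlog
  have hc (θ : ℝ) : ‖circleMap 0 ρ θ‖ = ρ := by simp [abs_of_pos hρ]
  have hc0 (θ : ℝ) : circleMap 0 ρ θ ≠ 0 := circleMap_ne_center hρ.ne'
  set s : ℝ → ℂ := fun θ => q / circleMap 0 ρ θ with hs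
  have hsc' : Continuous s := continuous_const.div (continuous_circleMap 0 ρ) hc0
  set h : ℝ → ℂ := fun θ => L (circleMap 0 ρ θ) (s θ) - L (circleMap 0 ρ θ) p with hh
  have hcont : Continuous h := by
    rw [continuous_iff_continuousAt]
    intro θ₀
    set η₀ := circleMap 0 ρ θ₀ with hη₀
    obtain ⟨γ, hγ⟩ := (hsc η₀ (hc θ₀)).isPathConnected.joinedIn p (hp _ (hc θ₀))
      (s θ₀) (hq _ (hc θ₀))
    obtain ⟨V, W, hV, hW, hηV, hKW, hVW⟩ := generalized_tube_lemma
      (isCompact_singleton (x := η₀)) (isCompact_range γ.continuous) hE (by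
        rintro ⟨x, y⟩ ⟨hx, t, rfl⟩
        obtain rfl : x = η₀ := hx
        exact hγ t)
    have hpK : p ∈ range γ := ⟨0, γ.source⟩
    have hsK : s θ₀ ∈ range γ := ⟨1, γ.target⟩
    obtain ⟨δ, hδ, hball⟩ := Metric.isOpen_iff.1 hW _ (hKW hsK)
    have hpre : IsPreconnected (range γ ∪ ball (s θ₀) δ) :=
      (isPreconnected_range γ.continuous).union _ hsK (mem_ball_self hδ)
        (convex_ball _ _).isPreconnected
    have hsub : range γ ∪ ball (s θ₀) δ ⊆ W := union_subset hKW hball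
    have hη₀V : η₀ ∈ V := hηV rfl
    have hsubF {η : ℂ} (hη : η ∈ V) : range γ ∪ ball (s θ₀) δ ⊆ {u | (η, u) ∈ E} :=
      fun u hu => hVW ⟨hη, hsub hu⟩
    have hev : ∀ᶠ θ in nhds θ₀, h θ = L η₀ (s θ) - L η₀ p := by
      filter_upwards [(continuous_circleMap 0 ρ).continuousAt.preimage_mem_nhds
        (hV.mem_nhds hη₀V), hsc'.continuousAt.preimage_mem_nhds (ball_mem_nhds _ hδ)]
        with θ hθV hθs
      have hθ0 := hc0 θ
      have := hpre.eq_of_exp_comp_eq (c := 1)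
        (f := fun u => L (circleMap 0 ρ θ) u - L η₀ u)
        (((hLc _ (hc θ)).mono (hsubF hθV)).sub ((hLc _ (hc θ₀)).mono (hsubF hη₀V)))
        (fun u hu => by
          have h1 := hLe _ (hc θ) (hsubF hθV hu)
          have h2 := hLe _ (hc θ₀) (hsubF hη₀V hu)
          simp only [Function.comp_apply, id] at h1 h2
          rw [exp_sub, h1, h2, div_self]
          rintro rfl
          exact h0 _ (hc θ) (hsubF hθV hu))
        (Or.inr hθs) (Or.inl hpK)
      simp only [hh]
      linear_combination this
    refine ContinuousAt.congr ?_ (hev.mono fun _ h => h.symm)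
    refine ContinuousAt.sub ?_ continuousAt_const
    exact ((hLc _ (hc θ₀)).continuousAt ((hopen η₀).mem_nhds (hq _ (hc θ₀)))).comp
      (f := s) hsc'.continuousAt
  have hexp (θ : ℝ) : exp (h θ + θ * I) = q / p / ρ := by
    have h1 := hLe _ (hc θ) (hq _ (hc θ))
    have h2 := hLe _ (hc θ) (hp _ (hc θ))
    simp only [Function.comp_apply, id] at h1 h2
    have hθ0 := exp_ne_zero (θ * I)
    have hρ0 : (ρ : ℂ) ≠ 0 := mod_cast hρ.ne'
    rw [exp_add, exp_sub, h1, h2, circleMap]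
    field_simp
    ring_nf
  have := isPreconnected_univ.eq_of_exp_comp_eq (f := fun θ : ℝ => h θ + θ * I)
    (by fun_prop) (fun θ _ => hexp θ) (mem_univ 0) (mem_univ (2 * Real.pi))
  have hper : h (2 * Real.pi) = h 0 := by
    have : circleMap 0 ρ (2 * Real.pi) = circleMap 0 ρ 0 := by
      simpa using periodic_circleMap 0 ρ 0
    simp only [hh, hs, this]
  rw [hper] at this
  simp [Real.pi_ne_zero] at this

/-- Let `a ∉ D` with `D` open and ℂ-convex. If every circle `{w • X + ν : ‖w‖ = R}` of directions
scales by a common factor into `D - a`, then the complex line through `a` in direction `X` misses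
`D`. -/
theorem IsCConvex.disjoint_cline {n : ℕ} {D : Set (Cn n)} (hD : IsOpen D) (hcc : IsCConvex D)
    {a X ν : Cn n} (ha : a ∉ D) (hν : ∀ w : ℂ, ν ≠ w • X)
    (hdir : ∀ R : ℝ, ∃ s : ℝ, ∀ w : ℂ, ‖w‖ = R → a + (s : ℂ) • (w • X + ν) ∈ D) (l : ℂ) :
    a + l • X ∉ D := by
  intro hl
  have hF : Continuous fun x : ℂ × ℂ => a + x.2 • (X + x.1 • ν) := by fun_prop
  have hE : IsOpen {x : ℂ × ℂ | a + x.2 • (X + x.1 • ν) ∈ D} := hD.preimage hF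
  have hnear : ∀ᶠ η : ℂ in nhds 0, a + l • (X + η • ν) ∈ D := by
    have : Continuous fun η : ℂ => a + l • (X + η • ν) := by fun_prop
    exact this.continuousAt.eventually_mem (hD.mem_nhds (by simpa using hl))
  obtain ⟨δ, hδ, hball⟩ := Metric.eventually_nhds_iff.1 hnear
  have hδ2 : 0 < δ / 2 := by positivity
  have hmem (η : ℂ) (hη : ‖η‖ = δ / 2) : a + l • (X + η • ν) ∈ D :=
    hball (by rw [dist_zero_right, hη]; linarith)
  obtain ⟨s, hs⟩ := hdir (δ / 2)⁻¹
  refine not_isSimplyConnected_fibers hE hδ2 (p := l) (q := s) ?_ (fun η _ => by simpa using ha)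
    hmem ?_
  · intro η hη
    have hη0 : η ≠ 0 := by rintro rfl; simp at hη; linarith
    have hY : X + η • ν ≠ 0 := by
      intro h
      refine hν (-η⁻¹) ?_
      have : ν = η⁻¹ • (η • ν) := by rw [smul_smul, inv_mul_cancel₀ hη0, one_smul]
      rw [this, eq_neg_of_add_eq_zero_right h]
      simp
    have hemb : Topology.IsEmbedding fun u : ℂ => a + u • (X + η • ν) :=
      (Homeomorph.addLeft a).isEmbedding.comp (isClosedEmbedding_smul_left hY).isEmbedding
    rw [← hemb.isSimplyConnected_image]
    have : (fun u : ℂ => a + u • (X + η • ν)) ''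
        {u | (η, u) ∈ {x : ℂ × ℂ | a + x.2 • (X + x.1 • ν) ∈ D}} =
        D ∩ cline a (X + η • ν) := by
      ext w
      constructor
      · rintro ⟨u, hu, rfl⟩
        exact ⟨hu, u, rfl⟩
      · rintro ⟨hw, u, rfl⟩
        exact ⟨u, hw, rfl⟩
    rw [this]
    exact (hcc _ _ hY ⟨_, hmem η hη, l, rfl⟩).2
  · intro η hη
    have hη0 : η ≠ 0 := by rintro rfl; simp at hη; linarith
    have := hs η⁻¹ (by rw [norm_inv, hη])
    change _ ∈ D
    convert this using 2
    rw [smul_add, smul_add, smul_smul, smul_smul, div_mul_cancel₀ _ hη0, div_eq_mul_inv]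

section Symmetry

universe u

/-- The iterated derivative of a `C^(n+1)` function is invariant under transposing two adjacent
arguments. -/
theorem ContDiffAt.iteratedFDeriv_comp_swap_castSucc_succ {E : Type u} [NormedAddCommGroup E]
    [NormedSpace ℝ E] {n : ℕ} {F : Type u} [NormedAddCommGroup F] [NormedSpace ℝ F]
    {f : E → F} {x : E} (hf : ContDiffAt ℝ (n + 1) f x) (i : Fin n) (v : Fin (n + 1) → E) :
    iteratedFDeriv ℝ (n + 1) f x (v ∘ Equiv.swap i.castSucc i.succ) =
      iteratedFDeriv ℝ (n + 1) f x v := by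
  induction n generalizing F with
  | zero => exact i.elim0
  | succ n ih =>
    have hf' : ContDiffAt ℝ (n + 1) (fderiv ℝ f) x := by
      refine hf.fderiv_right ?_
      norm_cast
    induction i using Fin.lastCases with
    | cast j =>
      rw [iteratedFDeriv_succ_apply_right]
      have h1 : Fin.init (v ∘ Equiv.swap j.castSucc.castSucc j.castSucc.succ) =
          Fin.init v ∘ Equiv.swap j.castSucc j.succ := by
        ext k
        simp only [Fin.init, Function.comp_apply, Fin.succ_castSucc]
        rw [(Fin.castSucc_injective (n + 1)).swap_apply]
      have h2 : (v ∘ Equiv.swap j.castSucc.castSucc j.castSucc.succ) (Fin.last (n + 1)) =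
          v (Fin.last (n + 1)) := by
        simp only [Function.comp_apply]
        rw [Equiv.swap_apply_of_ne_of_ne (Fin.castSucc_lt_last _).ne'
          (by rw [Fin.succ_castSucc]; exact (Fin.castSucc_lt_last _).ne')]
      rw [h1, h2, ih hf' j, ← iteratedFDeriv_succ_apply_right]
    | last =>
      set H : E → E →L[ℝ] E →L[ℝ] F := fun y => fderiv ℝ (fderiv ℝ f) y with hH
      have hD (u : Fin (n + 2) → E) : iteratedFDeriv ℝ (n + 1 + 1) f x u =
          iteratedFDeriv ℝ n H x (fun k => u k.castSucc.castSucc) (u (Fin.last n).castSucc)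
            (u (Fin.last (n + 1))) := by
        rw [iteratedFDeriv_succ_apply_right, iteratedFDeriv_succ_apply_right]
        rfl
      let Φ : (E →L[ℝ] E →L[ℝ] F) ≃L[ℝ] E →L[ℝ] E →L[ℝ] F :=
        (ContinuousLinearMap.flipₗᵢ ℝ E E F).toContinuousLinearEquiv
      have hflip : H =ᶠ[nhds x] Φ ∘ H := by
        filter_upwards [hf.eventually (by norm_cast; simp)] with y hy
        have hsymm : IsSymmSndFDerivAt ℝ f y := hy.isSymmSndFDerivAt (by
          rw [minSmoothness_of_isRCLikeNormedField]
          norm_cast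
          omega)
        ext a b
        exact hsymm.eq a b
      have hswap (w : Fin n → E) (p q : E) :
          iteratedFDeriv ℝ n H x w p q = iteratedFDeriv ℝ n H x w q p := by
        conv_lhs => rw [(hflip.iteratedFDeriv ℝ n).eq_of_nhds]
        have hcomp := ContinuousLinearEquiv.iteratedFDeriv_comp_left (𝕜 := ℝ)
          (F := E →L[ℝ] E →L[ℝ] F) (G := E →L[ℝ] E →L[ℝ] F) (f := H) (x := x) Φ (i := n)
        rw [hcomp]
        rfl
      rw [hD, hD, hswap]
      simp only [Function.comp_apply, Fin.succ_last, Equiv.swap_apply_left,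
        Equiv.swap_apply_right]
      congr 3
      ext k
      rw [Equiv.swap_apply_of_ne_of_ne]
      · simp only [ne_eq, Fin.castSucc_inj]
        exact (Fin.castSucc_lt_last k).ne
      · exact (Fin.castSucc_lt_last _).ne

/-- The iterated derivative of order `n` of a real `C^n` function is symmetric. -/
theorem ContDiffAt.iteratedFDeriv_comp_perm_of_real {E F : Type u} [NormedAddCommGroup E]
    [NormedSpace ℝ E] [NormedAddCommGroup F] [NormedSpace ℝ F] {n : ℕ}
    {f : E → F} {x : E} (hf : ContDiffAt ℝ n f x) (σ : Equiv.Perm (Fin n)) (v : Fin n → E) :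
    iteratedFDeriv ℝ n f x (v ∘ σ) = iteratedFDeriv ℝ n f x v := by
  cases n with
  | zero => congr 1; exact Subsingleton.elim _ _
  | succ n =>
    have hσ : σ ∈ Submonoid.closure
        (range fun i : Fin n => Equiv.swap i.castSucc i.succ) := by
      rw [Equiv.Perm.mclosure_swap_castSucc_succ]
      trivial
    induction hσ using Submonoid.closure_induction generalizing v with
    | mem σ hσ =>
      obtain ⟨i, rfl⟩ := hσ
      exact hf.iteratedFDeriv_comp_swap_castSucc_succ i v
    | one => rfl
    | mul σ τ _ _ hσ hτ =>
      rw [Equiv.Perm.coe_mul, ← Function.comp_assoc, hτ, hσ]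

/-- An iterated derivative that does not vanish is nonzero on some diagonal vector. -/
theorem ContDiffAt.exists_iteratedFDeriv_diag_ne_zero {E : Type} [NormedAddCommGroup E]
    [NormedSpace ℝ E] {g : E → ℝ} {x : E} {l : ℕ}
    (hg : ContDiffAt ℝ l g x) (hl : iteratedFDeriv ℝ l g x ≠ 0) :
    ∃ w : E, iteratedFDeriv ℝ l g x (fun _ => w) ≠ 0 := by
  by_contra! h
  refine hl (ContinuousMultilinearMap.ext fun v => ?_)
  have hsum := (iteratedFDeriv ℝ l g x).iteratedFDeriv_comp_diagonal 0 v
  have hperm (σ : Equiv.Perm (Fin l)) :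
      iteratedFDeriv ℝ l g x (fun i => v (σ i)) = iteratedFDeriv ℝ l g x v :=
    hg.iteratedFDeriv_comp_perm_of_real σ v
  simp only [h, hperm, Finset.sum_const, nsmul_eq_mul] at hsum
  have hcard : ((Finset.univ : Finset (Equiv.Perm (Fin l))).card : ℝ) ≠ 0 := by
    simp [Fintype.card_perm, Nat.factorial_ne_zero]
  refine (mul_eq_zero.1 (hsum.symm.trans ?_)).resolve_left hcard
  change iteratedFDeriv ℝ l (0 : E → ℝ) 0 v = 0
  simp

end Symmetry

section Taylor

variable {E : Type*} [NormedAddCommGroup E] [NormedSpace ℝ E]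

/-- Taylor's formula at a point where the lower order derivatives vanish. -/
theorem ContDiffAt.eventually_eq_integral_iteratedFDeriv {g : E → ℝ} {n : ℕ}
    (hg : ContDiffAt ℝ (n + 1) g 0) (hlow : ∀ k < n + 1, iteratedFDeriv ℝ k g 0 = 0) :
    ∃ ε > 0, ∀ y : E, ‖y‖ < ε →
      IntervalIntegrable (fun t : ℝ =>
        (1 - t) ^ n * iteratedFDeriv ℝ (n + 1) g (t • y) (fun _ => y)) volume 0 1 ∧
      g y = (n.factorial : ℝ)⁻¹ *
        ∫ t in 0..1, (1 - t) ^ n * iteratedFDeriv ℝ (n + 1) g (t • y) (fun _ => y) := by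
  obtain ⟨ε, hε, hball⟩ := Metric.eventually_nhds_iff.1 (hg.eventually (by simp))
  refine ⟨ε, hε, fun y hy => ?_⟩
  have hd (t : ℝ) (ht : t ∈ Icc (0 : ℝ) 1) : ContDiffAt ℝ (n + 1) g (t • y) := by
    refine hball ?_
    rw [dist_zero_right, norm_smul, Real.norm_of_nonneg ht.1]
    exact (mul_le_of_le_one_left (norm_nonneg _) ht.2).trans_lt hy
  constructor
  · refine ContinuousOn.intervalIntegrable fun t ht => ?_
    rw [uIcc_of_le zero_le_one] at ht
    have h1 : ContinuousAt (fun s : ℝ => iteratedFDeriv ℝ (n + 1) g (s • y)) t :=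
      ContinuousAt.comp (f := fun s : ℝ => s • y)
        ((hd t ht).continuousAt_iteratedFDeriv (by norm_cast)) (by fun_prop)
    have h2 : ContinuousAt (fun s : ℝ => iteratedFDeriv ℝ (n + 1) g (s • y) fun _ => y) t :=
      (ContinuousMultilinearMap.apply ℝ (fun _ : Fin (n + 1) => E) ℝ
        fun _ => y).continuous.continuousAt.comp h1
    exact (ContinuousAt.mul (by fun_prop) h2).continuousWithinAt
  · have := map_add_eq_sum_add_integral_iteratedFDeriv (x := (0 : E)) (y := y) (f := g) (n := n)
      (by simpa using hd)
    rw [Finset.sum_eq_zero fun k hk => by simp [hlow k (Finset.mem_range.1 hk)]] at this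
    simpa using this

/-- A function vanishing to order `n + 1` is bounded by `M ‖y‖ ^ (n + 1)`. -/
theorem ContDiffAt.eventually_le_mul_norm_pow {g : E → ℝ} {n : ℕ}
    (hg : ContDiffAt ℝ (n + 1) g 0) (hlow : ∀ k < n + 1, iteratedFDeriv ℝ k g 0 = 0) :
    ∃ M > 0, ∃ ε > 0, ∀ y : E, ‖y‖ < ε → g y ≤ M * ‖y‖ ^ (n + 1) := by
  obtain ⟨ε₁, hε₁, hT⟩ := hg.eventually_eq_integral_iteratedFDeriv hlow
  set M := ‖iteratedFDeriv ℝ (n + 1) g 0‖ + 1 with hM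
  have hM0 : 0 < M := by positivity
  have hcont := (hg.continuousAt_iteratedFDeriv (k := n + 1) (by norm_cast)).norm
  obtain ⟨ε₂, hε₂, hB⟩ := Metric.eventually_nhds_iff.1
    (hcont.eventually_lt (continuousAt_const (y := M)) (by simp [hM]))
  refine ⟨M, hM0, min ε₁ ε₂, lt_min hε₁ hε₂, fun y hy => ?_⟩
  rw [lt_min_iff] at hy
  obtain ⟨-, heq⟩ := hT y hy.1
  have h_int : ‖∫ t in (0 : ℝ)..1, (1 - t) ^ n * iteratedFDeriv ℝ (n + 1) g (t • y) (fun _ => y)‖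
      ≤ M * ‖y‖ ^ (n + 1) * |1 - 0| := by
    refine intervalIntegral.norm_integral_le_of_norm_le_const fun t ht => ?_
    rw [uIoc_of_le zero_le_one] at ht
    have h1 : ‖(1 - t) ^ n‖ ≤ 1 := by
      rw [norm_pow, Real.norm_of_nonneg (by linarith [ht.2])]
      exact pow_le_one₀ (by linarith [ht.2]) (by linarith [ht.1])
    have h2 : ‖iteratedFDeriv ℝ (n + 1) g (t • y) (fun _ => y)‖ ≤ M * ‖y‖ ^ (n + 1) := by
      refine ((iteratedFDeriv ℝ (n + 1) g (t • y)).le_opNorm _).trans ?_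
      simp only [Finset.prod_const, Finset.card_univ, Fintype.card_fin]
      gcongr
      refine (hB ?_).le
      rw [dist_zero_right, norm_smul, Real.norm_of_nonneg ht.1.le]
      exact (mul_le_of_le_one_left (norm_nonneg _) ht.2).trans_lt hy.2
    rw [norm_mul]
    exact (mul_le_of_le_one_left (norm_nonneg _) h1).trans h2
  rw [sub_zero, abs_one, mul_one] at h_int
  have hfac : ((n.factorial : ℝ))⁻¹ ≤ 1 :=
    inv_le_one_of_one_le₀ (mod_cast n.factorial_pos)
  rw [heq]
  calc _ ≤ (n.factorial : ℝ)⁻¹ * (M * ‖y‖ ^ (n + 1)) := by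
        gcongr
        exact (Real.le_norm_self _).trans h_int
    _ ≤ M * ‖y‖ ^ (n + 1) := mul_le_of_le_one_left (by positivity) hfac

/-- A function vanishing to order `n + 1` grows like `s ^ (n + 1)` along a direction in which its
derivative of order `n + 1` is positive. -/
theorem ContDiffAt.eventually_mul_pow_le {g : E → ℝ} {n : ℕ}
    (hg : ContDiffAt ℝ (n + 1) g 0) (hlow : ∀ k < n + 1, iteratedFDeriv ℝ k g 0 = 0)
    {w : E} (hw : 0 < iteratedFDeriv ℝ (n + 1) g 0 (fun _ => w)) :
    ∃ c > 0, ∃ δ > 0, ∀ s : ℝ, 0 ≤ s → s < δ → c * s ^ (n + 1) ≤ g (s • w) := by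
  obtain ⟨ε₁, hε₁, hT⟩ := hg.eventually_eq_integral_iteratedFDeriv hlow
  set m := iteratedFDeriv ℝ (n + 1) g 0 (fun _ => w) with hm
  have hcont : ContinuousAt (fun y => iteratedFDeriv ℝ (n + 1) g y fun _ => w) 0 :=
    (ContinuousMultilinearMap.apply ℝ (fun _ : Fin (n + 1) => E) ℝ
      fun _ => w).continuous.continuousAt.comp
      (hg.continuousAt_iteratedFDeriv (k := n + 1) (by norm_cast))
  obtain ⟨ε₂, hε₂, hB⟩ := Metric.eventually_nhds_iff.1
    ((continuousAt_const (y := m / 2)).eventually_lt hcont (by linarith))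
  have hw0 : 0 < ‖w‖ + 1 := by positivity
  refine ⟨(n.factorial : ℝ)⁻¹ * (m / 2 * (n + 1 : ℝ)⁻¹), by positivity,
    min ε₁ ε₂ / (‖w‖ + 1), by positivity, fun s hs0 hs => ?_⟩
  have hsw : ‖s • w‖ < min ε₁ ε₂ := by
    rw [lt_div_iff₀ hw0] at hs
    rw [norm_smul, Real.norm_of_nonneg hs0]
    nlinarith
  rw [lt_min_iff] at hsw
  obtain ⟨h_int, heq⟩ := hT _ hsw.1
  have hpow : ∫ t in (0 : ℝ)..1, (1 - t) ^ n * (m / 2 * s ^ (n + 1)) =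
      m / 2 * (n + 1 : ℝ)⁻¹ * s ^ (n + 1) := by
    rw [intervalIntegral.integral_mul_const,
      intervalIntegral.integral_comp_sub_left (fun t : ℝ => t ^ n) 1]
    simp
    ring
  have hle : ∫ t in (0 : ℝ)..1, (1 - t) ^ n * (m / 2 * s ^ (n + 1)) ≤
      ∫ t in (0 : ℝ)..1, (1 - t) ^ n *
        iteratedFDeriv ℝ (n + 1) g (t • s • w) (fun _ => s • w) := by
    refine intervalIntegral.integral_mono_on zero_le_one
      (Continuous.intervalIntegrable (by fun_prop) _ _) h_int fun t ht => ?_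
    have hmul := (iteratedFDeriv ℝ (n + 1) g (t • s • w)).map_smul_univ (fun _ => s) (fun _ => w)
    simp only [Finset.prod_const, Finset.card_univ, Fintype.card_fin, smul_eq_mul] at hmul
    rw [hmul, mul_comm (s ^ (n + 1))]
    have h1 : 0 ≤ 1 - t := by linarith [ht.2]
    gcongr
    refine (hB ?_).le
    rw [dist_zero_right, norm_smul, Real.norm_of_nonneg ht.1]
    exact (mul_le_of_le_one_left (norm_nonneg _) ht.2).trans_lt hsw.2
  rw [heq, mul_assoc]
  gcongr
  exact hpow ▸ hle

end Taylor

section Geometry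

/-- Near a point where the strict derivative `f` is nonzero, a function is Lipschitz, and along a
unit vector of steepest descent it decreases at a definite rate. -/
theorem HasStrictFDerivAt.exists_ball_bounds {E : Type*} [NormedAddCommGroup E] [NormedSpace ℝ E]
    {r : E → ℝ} {f : E →L[ℝ] ℝ} {a ν : E} (hr : HasStrictFDerivAt r f a) (hf : f ≠ 0)
    (hν1 : ‖ν‖ = 1) (hν2 : f ν = -‖f‖) {U : Set E} (hU : U ∈ nhds a) :
    ∃ ρ > 0, ball a ρ ⊆ U ∧
      (∀ x ∈ ball a ρ, ∀ y ∈ ball a ρ, |r y - r x| ≤ 3 / 2 * ‖f‖ * ‖y - x‖) ∧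
      ∀ x ∈ ball a ρ, ∀ t : ℝ, 0 ≤ t → x + t • ν ∈ ball a ρ →
        r (x + t • ν) ≤ r x - ‖f‖ / 2 * t := by
  have hm : 0 < ‖f‖ := norm_pos_iff.2 hf
  obtain ⟨ρ₁, hρ₁, h₁⟩ := Metric.eventually_nhds_iff.1 (hr.isLittleO.def (half_pos hm))
  obtain ⟨ρ₂, hρ₂, h₂⟩ := Metric.mem_nhds_iff.1 hU
  have key (x : E) (hx : x ∈ ball a (min ρ₁ ρ₂)) (y : E) (hy : y ∈ ball a (min ρ₁ ρ₂)) :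
      |r y - r x - f (y - x)| ≤ ‖f‖ / 2 * ‖y - x‖ := by
    refine h₁ (y := (y, x)) ?_
    rw [Prod.dist_eq, max_lt_iff]
    exact ⟨(mem_ball.1 hy).trans_le (min_le_left _ _), (mem_ball.1 hx).trans_le (min_le_left _ _)⟩
  refine ⟨min ρ₁ ρ₂, lt_min hρ₁ hρ₂, (ball_subset_ball (min_le_right _ _)).trans h₂,
    fun x hx y hy => ?_, fun x hx t ht hy => ?_⟩
  · have h := abs_le.1 (key x hx y hy)
    have h' := abs_le.1 (f.le_opNorm (y - x))
    rw [abs_le]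
    constructor <;> linarith [h.1, h.2, h'.1, h'.2]
  · have h := (abs_le.1 (key x hx _ hy)).2
    rw [add_sub_cancel_left, map_smul, norm_smul, hν1, hν2, Real.norm_of_nonneg ht,
      smul_eq_mul] at h
    linarith

/-- On a transversal to the boundary, the parameter is comparable to the distance to the
boundary. -/
theorem le_infDist_frontier {E : Type*} [NormedAddCommGroup E] [NormedSpace ℝ E] {D U : Set E}
    {r : E → ℝ} {a ν : E} {m ρ t : ℝ} (ha : a ∈ frontier D) (haU : a ∈ U) (hm : 0 < m)
    (hν : ‖ν‖ = 1) (hbd : frontier D ∩ U = {x ∈ U | r x = 0}) (hρ : ball a ρ ⊆ U)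
    (hlip : ∀ x ∈ ball a ρ, ∀ y ∈ ball a ρ, |r y - r x| ≤ 3 / 2 * m * ‖y - x‖)
    (hdec : ∀ x ∈ ball a ρ, ∀ t : ℝ, 0 ≤ t → x + t • ν ∈ ball a ρ →
      r (x + t • ν) ≤ r x - m / 2 * t) (ht : 0 ≤ t) (htρ : t < ρ / 2) :
    t / 3 ≤ infDist (a + t • ν) (frontier D) := by
  have hra : r a = 0 := (hbd.subset ⟨ha, haU⟩).2
  have hz : a + t • ν ∈ ball a ρ := by
    rw [mem_ball_iff_norm, add_sub_cancel_left, norm_smul, hν, Real.norm_of_nonneg ht]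
    linarith
  refine (le_infDist ⟨a, ha⟩).2 fun y hy => ?_
  by_cases hyρ : y ∈ ball a ρ
  · have hry : r y = 0 := (hbd.subset ⟨hy, hρ hyρ⟩).2
    have h1 := hdec a (mem_ball_self (by linarith)) t ht hz
    have h2 := (abs_le.1 (hlip _ hz y hyρ)).2
    rw [dist_comm, dist_eq_norm]
    rw [hra] at h1
    rw [hry] at h2
    by_contra! h
    nlinarith
  · rw [mem_ball, not_lt] at hyρ
    have h1 : dist (a + t • ν) a = t := by
      rw [dist_eq_norm, add_sub_cancel_left, norm_smul, hν, Real.norm_of_nonneg ht, mul_one]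
    have h2 := dist_triangle y (a + t • ν) a
    rw [dist_comm]
    linarith

/-- A complex tangent line to a ℂ-convex domain at a smooth boundary point misses the domain. -/
theorem IsCConvex.tangent_notMem {n : ℕ} {D U : Set (Cn n)} (hD : IsOpen D) (hcc : IsCConvex D)
    {r : Cn n → ℝ} {f : Cn n →L[ℝ] ℝ} {a X ν : Cn n} (haD : a ∉ D) (hra : r a = 0)
    (hU : U ∈ nhds a) (hsub : D ∩ U = {x ∈ U | r x < 0}) (hr : HasFDerivAt r f a)
    (hν : f ν < 0) (hX : ∀ w : ℂ, f (w • X) = 0) (l : ℂ) : a + l • X ∉ D := by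
  refine hcc.disjoint_cline hD haD (ν := ν) (fun w hw => ?_) (fun R => ?_) l
  · rw [hw, hX] at hν
    exact lt_irrefl _ hν
  set K : ℝ := |R| * ‖X‖ + ‖ν‖ + 1 with hK
  have hK0 : 0 < K := by positivity
  obtain ⟨ε, hε, h⟩ := Metric.eventually_nhds_iff.1
    ((hr.isLittleO.def (div_pos (neg_pos.2 hν) hK0)).and hU)
  refine ⟨ε / K / 2, fun w hw => ?_⟩
  set s : ℝ := ε / K / 2 with hs
  have hs0 : 0 < s := by positivity
  have hv : ‖w • X + ν‖ < K := by
    have := norm_add_le (w • X) ν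
    rw [norm_smul, hw] at this
    nlinarith [le_abs_self R, norm_nonneg X]
  have hnorm : ‖s • (w • X + ν)‖ < s * K := by
    rw [norm_smul, Real.norm_of_nonneg hs0.le]
    gcongr
  have hsK : s * K = ε / 2 := by
    rw [hs]
    field_simp
  rw [Complex.coe_smul]
  obtain ⟨h1, h2⟩ := h (y := a + s • (w • X + ν)) (by
    rw [dist_eq_norm, add_sub_cancel_left]
    linarith)
  refine (hsub.symm.subset ⟨h2, ?_⟩).1
  rw [add_sub_cancel_left, hra, map_smul, map_add, hX, zero_add, smul_eq_mul, sub_zero] at h1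
  have h3 := (abs_le.1 h1).2
  have h4 : -f ν / K * ‖s • (w • X + ν)‖ < -f ν * s := by
    rw [div_mul_eq_mul_div, div_lt_iff₀ hK0, mul_assoc]
    exact mul_lt_mul_of_pos_left hnorm (neg_pos.2 hν)
  change r _ < 0
  linarith

theorem dirDist_le {n : ℕ} {D : Set (Cn n)} {z X : Cn n} {w : ℂ} (hw : z + w • X ∉ D) :
    dirDist D z X ≤ ‖w‖ :=
  Real.sSup_le (fun _ hR => not_lt.1 fun h => hw (hR.2 w h)) (norm_nonneg w)

theorem le_dirDist {n : ℕ} {D : Set (Cn n)} {z X : Cn n} {w : ℂ} (hw : z + w • X ∉ D) {R : ℝ}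
    (hR : 0 < R) (h : ∀ u : ℂ, ‖u‖ < R → z + u • X ∈ D) : R ≤ dirDist D z X :=
  le_csSup ⟨‖w‖, fun _ hR => not_lt.1 fun h => hw (hR.2 w h)⟩ ⟨hR, h⟩

/-- The restriction of a defining function to a complex line through a boundary point has a
positive value of its leading homogeneous Taylor term. -/
theorem IsCConvex.exists_iteratedFDeriv_diag_pos {n : ℕ} {D U : Set (Cn n)} (hD : IsOpen D)
    (hcc : IsCConvex D) {r : Cn n → ℝ} {f : Cn n →L[ℝ] ℝ} {a X ν : Cn n} (haD : a ∉ D)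
    (hra : r a = 0) (hU : U ∈ nhds a) (hsub : D ∩ U = {x ∈ U | r x < 0}) (hr : HasFDerivAt r f a)
    (hν : f ν < 0) {k : ℕ} (hg : ContDiffAt ℝ (k + 1) (fun w : ℂ => r (a + w • X)) 0)
    (hlow : ∀ j < k + 1, iteratedFDeriv ℝ j (fun w : ℂ => r (a + w • X)) 0 = 0)
    (hord : iteratedFDeriv ℝ (k + 1) (fun w : ℂ => r (a + w • X)) 0 ≠ 0) :
    ∃ w : ℂ, 0 < iteratedFDeriv ℝ (k + 1) (fun w : ℂ => r (a + w • X)) 0 (fun _ => w) := by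
  set g : ℂ → ℝ := fun w => r (a + w • X) with hgdef
  obtain ⟨w, hw⟩ := ContDiffAt.exists_iteratedFDeriv_diag_ne_zero (l := k + 1)
    (by exact_mod_cast hg) hord
  rcases lt_or_gt_of_ne hw with hneg | hpos
  swap
  · exact ⟨w, hpos⟩
  rcases Nat.eq_zero_or_pos k with rfl | hk
  · refine ⟨-w, ?_⟩
    rw [iteratedFDeriv_one_apply] at hneg ⊢
    simpa using hneg
  exfalso
  have hg1 : fderiv ℝ g 0 = 0 := by
    ext v
    have := congrArg (fun T => T fun _ => v) (hlow 1 (by omega))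
    simpa [iteratedFDeriv_one_apply] using this
  set L : ℂ →L[ℝ] Cn n := (ContinuousLinearMap.id ℂ ℂ).smulRight X |>.restrictScalars ℝ with hL
  have hgd : HasFDerivAt g (f ∘L L) 0 := by
    have h1 : HasFDerivAt (fun w : ℂ => a + w • X) L 0 := by
      have : HasFDerivAt (fun w : ℂ => L w) L 0 := L.hasFDerivAt
      simpa [hL] using this.const_add a
    refine HasFDerivAt.comp (g := r) (0 : ℂ) ?_ h1
    simpa using hr
  have hfX (u : ℂ) : f (u • X) = 0 := by
    have := congrArg (fun T => T u) (hgd.fderiv.symm.trans hg1)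
    simpa [hL] using this
  have hmiss := hcc.tangent_notMem hD haD hra hU hsub hr hν hfX
  have hneg' : 0 < iteratedFDeriv ℝ (k + 1) (-g) 0 (fun _ => w) := by
    rw [iteratedFDeriv_neg]
    simpa using hneg
  obtain ⟨c, hc, δ, hδ, hgrow⟩ := ContDiffAt.eventually_mul_pow_le (g := -g) hg.neg
    (fun j hj => by rw [iteratedFDeriv_neg]; simp [hlow j hj]) hneg'
  have hcont : ContinuousAt (fun s : ℝ => a + (s • w) • X) 0 := by fun_prop
  obtain ⟨ε, hε, hsU⟩ := Metric.eventually_nhds_iff.1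
    (hcont.eventually_mem (s := U) (by simpa using hU))
  have hs0 : 0 < min δ ε / 2 := by positivity
  have hsδ : min δ ε / 2 < δ := by linarith [min_le_left δ ε]
  have hsε : min δ ε / 2 < ε := by linarith [min_le_right δ ε]
  have h1 := hgrow _ hs0.le hsδ
  have h2 := hsU (y := min δ ε / 2) (by
    rwa [dist_zero_right, Real.norm_of_nonneg hs0.le])
  refine hmiss _ (hsub.symm.subset ⟨h2, ?_⟩).1
  have : 0 < c * (min δ ε / 2) ^ (k + 1) := by positivity
  simp only [Pi.neg_apply, hgdef] at h1
  change r _ < 0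
  linarith

end Geometry

/-- Let `a` be a smooth boundary point of a ℂ-convex domain `D` and let
`X ≠ 0` have finite line type `l = l_{a,X}` (the order of vanishing of `λ ↦ r(a + λX)` at
`0`). Then, on the inner normal `n_a = {a + tν : t ∈ ℝ}` near `a`, the quantities `d_D(z)`
and `d_D(z,X)^l` are comparable. -/
theorem statement5 {n : ℕ} (D : Set (Cn n)) (hD : IsDomain' D) (hcc : IsCConvex D)
    (a : Cn n) (ha : a ∈ frontier D)
    (U : Set (Cn n)) (hU : IsOpen U) (haU : a ∈ U) (r : Cn n → ℝ)
    (hr : ContDiffOn ℝ (⊤ : ℕ∞) r U) (hgrad : ∀ x ∈ U, fderiv ℝ r x ≠ 0)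
    (hsub : D ∩ U = {x ∈ U | r x < 0})
    (hbd : frontier D ∩ U = {x ∈ U | r x = 0})
    (X : Cn n) (hX : X ≠ 0) (l : ℕ)
    (hlow : ∀ k < l, iteratedFDeriv ℝ k (fun w : ℂ => r (a + w • X)) 0 = 0)
    (hord : iteratedFDeriv ℝ l (fun w : ℂ => r (a + w • X)) 0 ≠ 0)
    (ν : Cn n) (hν1 : ‖ν‖ = 1) (hν2 : fderiv ℝ r a ν = -‖fderiv ℝ r a‖) :
    ∃ U' ∈ nhds a, ∃ c > (1:ℝ), ∀ z ∈ D ∩ U', (∃ t : ℝ, z = a + t • ν) →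
      c⁻¹ * bdist D z ≤ dirDist D z X ^ l ∧ dirDist D z X ^ l ≤ c * bdist D z := by
  obtain ⟨hDo, -⟩ := hD
  have hUa : U ∈ nhds a := hU.mem_nhds haU
  have hra : r a = 0 := (hbd.subset ⟨ha, haU⟩).2
  have haD : a ∉ D := fun h => by
    have : r a < 0 := (hsub.subset ⟨h, haU⟩).2
    linarith
  have hl0 : l ≠ 0 := by
    rintro rfl
    refine hord (ContinuousMultilinearMap.ext fun v => ?_)
    simp [hra]
  obtain ⟨k, rfl⟩ := Nat.exists_eq_succ_of_ne_zero hl0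
  rw [Nat.succ_eq_add_one] at *
  have hra' : ContDiffAt ℝ (⊤ : ℕ∞) r a := hr.contDiffAt hUa
  have hst : HasStrictFDerivAt r (fderiv ℝ r a) a := hra'.hasStrictFDerivAt (by simp)
  have hf := hgrad a haU
  set m := ‖fderiv ℝ r a‖ with hm
  have hm0 : 0 < m := norm_pos_iff.2 hf
  obtain ⟨ρ, hρ, hρU, hlip, hdec⟩ := hst.exists_ball_bounds hf hν1 hν2 hUa
  rw [← hm] at hlip hdec
  have hg : ContDiffAt ℝ (k + 1) (fun w : ℂ => r (a + w • X)) 0 := by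
    refine ContDiffAt.comp (g := r) (f := fun w : ℂ => a + w • X) (0 : ℂ) ?_ (by fun_prop)
    rw [zero_smul, add_zero]
    exact hra'.of_le (by exact_mod_cast le_top)
  obtain ⟨w, hw⟩ := hcc.exists_iteratedFDeriv_diag_pos hDo haD hra hUa hsub hst.hasFDerivAt
    (by rw [hν2]; linarith) hg hlow hord
  obtain ⟨M, hM, ε, hε, hupper⟩ := hg.eventually_le_mul_norm_pow hlow
  obtain ⟨c, hc, δ, hδ, hlower⟩ := hg.eventually_mul_pow_le hlow hw
  have hX0 : 0 < ‖X‖ := norm_pos_iff.2 hX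
  set B := m / 2 / M with hB
  set A := 3 / 2 * m / c with hA
  have hB0 : 0 < B := by positivity
  have hA0 : 0 < A := by positivity
  set e : ℝ := ((k + 1 : ℕ) : ℝ)⁻¹ with he
  have he0 : 0 < e := by positivity
  have hroot (b : ℝ) : Filter.Tendsto (fun t : ℝ => (b * t) ^ e) (nhds 0) (nhds 0) := by
    have : ContinuousAt (fun t : ℝ => (b * t) ^ e) 0 :=
      ContinuousAt.rpow_const (by fun_prop) (Or.inr he0.le)
    simpa [ContinuousAt, Real.zero_rpow he0.ne'] using this
  have hpow {b t : ℝ} (hbt : 0 ≤ b * t) : ((b * t) ^ e) ^ (k + 1) = b * t :=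
    Real.rpow_inv_natCast_pow hbt k.succ_ne_zero
  obtain ⟨τ, hτ, hsmall⟩ := Metric.eventually_nhds_iff.1
    (((hroot B).eventually_lt_const (u := min ε (ρ / 2 / ‖X‖)) (by positivity)).and
      ((hroot A).eventually_lt_const (u := min δ (ρ / 2 / (‖w‖ * ‖X‖ + 1))) (by positivity)))
  have hnν (t : ℝ) : ‖t • ν‖ = |t| := by rw [norm_smul, hν1, mul_one, Real.norm_eq_abs]
  refine ⟨ball a (min τ (ρ / 2)), ball_mem_nhds _ (by positivity),
    1 + B⁻¹ + 3 * (A * ‖w‖ ^ (k + 1)), by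
      have : 0 ≤ 3 * (A * ‖w‖ ^ (k + 1)) := by positivity
      have : 0 < B⁻¹ := by positivity
      linarith, ?_⟩
  rintro z ⟨hzD, hz⟩ ⟨t, rfl⟩
  rw [mem_ball_iff_norm, add_sub_cancel_left, hnν, lt_min_iff] at hz
  obtain ⟨htτ, htρ⟩ := hz
  have hball (v : Cn n) (hv : ‖v‖ < ρ / 2) : a + t • ν + v ∈ ball a ρ := by
    rw [mem_ball_iff_norm, add_assoc, add_sub_cancel_left]
    have := norm_add_le (t • ν) v
    rw [hnν] at this
    linarith
  have hzρ : a + t • ν ∈ ball a ρ := by simpa using hball 0 (by simpa using hρ)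
  have ht0 : 0 < t := by
    by_contra! ht
    have h1 := hdec _ hzρ (-t) (by linarith) (by
      rw [neg_smul, add_neg_cancel_right]
      exact mem_ball_self hρ)
    rw [neg_smul, add_neg_cancel_right, hra] at h1
    have h2 : r (a + t • ν) < 0 := (hsub.subset ⟨hzD, hρU hzρ⟩).2
    nlinarith
  rw [abs_of_pos ht0] at htτ htρ
  obtain ⟨hRlt, hSlt⟩ := hsmall (y := t) (by rwa [dist_zero_right, Real.norm_of_nonneg ht0.le])
  rw [lt_min_iff] at hRlt hSlt
  have hinf_ge := le_infDist_frontier ha haU hm0 hν1 hbd hρU hlip hdec ht0.le htρ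
  have hinf_le : infDist (a + t • ν) (frontier D) ≤ t := by
    refine (infDist_le_dist_of_mem ha).trans_eq ?_
    rw [dist_eq_norm, add_sub_cancel_left, hnν, abs_of_pos ht0]
  change t / 3 ≤ bdist D _ at hinf_ge
  change bdist D _ ≤ t at hinf_le
  set R := (B * t) ^ e with hR
  set s := (A * t) ^ e with hs
  have hR0 : 0 < R := by positivity
  have hs0 : 0 < s := by positivity
  have hRpow : R ^ (k + 1) = B * t := hpow (by positivity)
  have hspow : s ^ (k + 1) = A * t := hpow (by positivity)
  have hin (u : ℂ) (hu : ‖u‖ < R) : a + t • ν + u • X ∈ D := by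
    have huX : ‖u • X‖ < ρ / 2 := by
      rw [norm_smul, ← lt_div_iff₀ hX0]
      exact hu.trans hRlt.2
    have hmem := hball _ huX
    refine (hsub.symm.subset ⟨hρU hmem, ?_⟩).1
    have hmem' : a + u • X ∈ ball a ρ := by
      rw [mem_ball_iff_norm, add_sub_cancel_left]
      linarith
    have hcomm : a + t • ν + u • X = a + u • X + t • ν := by abel
    rw [hcomm] at hmem ⊢
    have h1 := hdec _ hmem' t ht0.le hmem
    have h2 := hupper u (hu.trans hRlt.1)
    have h3 : M * ‖u‖ ^ (k + 1) < M * R ^ (k + 1) := by gcongr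
    have h4 : M * (B * t) = m / 2 * t := by rw [hB]; field_simp
    rw [hRpow, h4] at h3
    change r _ < 0
    linarith
  have hout : a + t • ν + (s • w) • X ∉ D := by
    intro h
    have hsX : ‖(s • w) • X‖ < ρ / 2 := by
      have := hSlt.2
      rw [lt_div_iff₀ (by positivity)] at this
      rw [norm_smul, norm_smul, Real.norm_of_nonneg hs0.le]
      linarith
    have hmem := hball _ hsX
    have hmem' : a + (s • w) • X ∈ ball a ρ := by
      rw [mem_ball_iff_norm, add_sub_cancel_left]
      linarith
    have h0 : r (a + t • ν + (s • w) • X) < 0 := (hsub.subset ⟨h, hρU hmem⟩).2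
    have h1 := (abs_le.1 (hlip _ hmem' _ hmem)).1
    have h2 := hlower s hs0.le hSlt.1
    have hdiff : a + t • ν + (s • w) • X - (a + (s • w) • X) = t • ν := by abel
    rw [hdiff, hnν, abs_of_pos ht0] at h1
    have h4 : c * (A * t) = 3 / 2 * m * t := by rw [hA]; field_simp
    rw [hspow, h4] at h2
    linarith
  have hdge := le_dirDist hout hR0 hin
  have hdle := dirDist_le hout
  have hge : B * t ≤ dirDist D (a + t • ν) X ^ (k + 1) := by
    rw [← hRpow]
    gcongr
  have hle : dirDist D (a + t • ν) X ^ (k + 1) ≤ A * ‖w‖ ^ (k + 1) * t := by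
    have hnorm : ‖s • w‖ = s * ‖w‖ := by rw [norm_smul, Real.norm_of_nonneg hs0.le]
    calc _ ≤ ‖s • w‖ ^ (k + 1) := by
          have := hR0.le.trans hdge
          gcongr
      _ = A * ‖w‖ ^ (k + 1) * t := by rw [hnorm, mul_pow, hspow]; ring
  have hbd0 : 0 ≤ bdist D (a + t • ν) := infDist_nonneg
  have hA1 : 0 ≤ A * ‖w‖ ^ (k + 1) := by positivity
  have hBi : 0 < B⁻¹ := by positivity
  constructor
  · refine le_trans ?_ hge
    have : (1 + B⁻¹ + 3 * (A * ‖w‖ ^ (k + 1)))⁻¹ ≤ B := inv_le_of_inv_le₀ hB0 (by linarith)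
    gcongr
  · refine hle.trans ?_
    nlinarith [mul_nonneg hA1 (sub_nonneg.2 hinf_ge), mul_nonneg hBi.le hbd0]

end
end
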